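/- arXiv:0802.2157 — 2 statements merged into one kernel-verified Lean document; each statement's English description precedes it below -/
import Mathlib

section
/- If a finite simple graph G is 2-choosable, then G is also (4:2)-choosable. -/
/-- A graph `G` is `(a:b)`-choosable if for every assignment of color sets of size `a`
to the vertices, one can choose subsets of size `b` that are disjoint on adjacent vertices. -/
def SimpleGraph.Choosable {V : Type*} (G : SimpleGraph V) (a b : ℕ) : Prop :=
  ∀ S : V → Finset ℕ, (∀ v, (S v).card = a) →
    ∃ C : V → Finset ℕ, (∀ v, C v ⊆ S v) ∧ (∀ v, (C v).card = b) ∧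
      ∀ u v, G.Adj u v → Disjoint (C u) (C v)

/-- The `k`-th choice number of `G`: the least `n` such that `G` is `(n:k)`-choosable. -/
noncomputable def SimpleGraph.chooseNum {V : Type*} (G : SimpleGraph V) (k : ℕ) : ℕ :=
  sInf {n | G.Choosable n k}

section

open Finset

lemma three_mem_of_three_le_card_inter (A : Finset ℕ) (a b c d : ℕ)
    (h : 3 ≤ (A ∩ {a, b, c, d}).card) :
    (a ∈ A ∧ b ∈ A ∧ c ∈ A ∧ a ≠ b ∧ a ≠ c ∧ b ≠ c) ∨
    (a ∈ A ∧ b ∈ A ∧ d ∈ A ∧ a ≠ b ∧ a ≠ d ∧ b ≠ d) ∨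
    (a ∈ A ∧ c ∈ A ∧ d ∈ A ∧ a ≠ c ∧ a ≠ d ∧ c ≠ d) ∨
    (b ∈ A ∧ c ∈ A ∧ d ∈ A ∧ b ≠ c ∧ b ≠ d ∧ c ≠ d) := by
  obtain ⟨p, q, r, hp, hq, hr, h1, h2, h3⟩ := Finset.two_lt_card_iff.1 h
  clear h
  simp only [Finset.mem_inter, Finset.mem_insert, Finset.mem_singleton] at hp hq hr
  obtain ⟨hp, rfl | rfl | rfl | rfl⟩ := hp <;> obtain ⟨hq, rfl | rfl | rfl | rfl⟩ := hq <;>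
  obtain ⟨hr, rfl | rfl | rfl | rfl⟩ := hr <;>
  first
  | exact absurd rfl h1
  | exact absurd rfl h2
  | exact absurd rfl h3
  | simp_all [eq_comm]

lemma exists_fourth_mem (A : Finset ℕ) (hA : A.card = 4) (a b c : ℕ) (ha : a ∈ A) (hb : b ∈ A)
    (hc : c ∈ A) (h1 : a ≠ b) (h2 : a ≠ c) (h3 : b ≠ c) :
    ∃ g, ∀ x, x ∈ A ↔ x = a ∨ x = b ∨ x = c ∨ x = g := by
  have h : ({a, b, c} : Finset ℕ) ⊆ A := by grind
  have h' := card_sdiff_of_subset h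
  rw [hA, card_eq_three.2 ⟨a, b, c, h1, h2, h3, rfl⟩, card_eq_one] at h'
  obtain ⟨g, hg⟩ := h'
  refine ⟨g, fun x => ?_⟩
  have := congrArg (x ∈ ·) hg
  simp only [mem_sdiff, mem_insert, mem_singleton] at this
  grind

lemma false_of_switch_triples (A B : Finset ℕ) (hA : A.card = 4) (hB : B.card = 4)
    (t z a1 a2 f b1 b2 : ℕ)
    (h1 : t ≠ z) (h2 : t ≠ a1) (h3 : t ≠ a2) (h4 : z ≠ a1) (h5 : z ≠ a2) (h6 : a1 ≠ a2)
    (h7 : z ≠ f) (h8 : z ≠ b1) (h9 : z ≠ b2) (h10 : f ≠ b1) (h11 : f ≠ b2) (h12 : b1 ≠ b2)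
    (k4 : 3 ≤ (A ∩ {a1, z, b1, z}).card ∨ 3 ≤ (B ∩ {a1, z, b1, z}).card)
    (k5 : 3 ≤ (A ∩ {a2, z, b2, z}).card ∨ 3 ≤ (B ∩ {a2, z, b2, z}).card)
    (k6 : 3 ≤ (A ∩ {a1, a2, b1, b2}).card ∨ 3 ≤ (B ∩ {a1, a2, b1, b2}).card)
    (y1 y2 y3 : ℕ) (hf : ∀ x, (x = y1 ∨ x = y2 ∨ x = y3) ↔ (x = f ∨ x = b1 ∨ x = b2))
    (hy1 : y1 ≠ y2) (hy2 : y1 ≠ y3) (hy3 : y2 ≠ y3)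
    (k1 : 3 ≤ (A ∩ {t, z, z, y1}).card)
    (k2 : 3 ≤ (A ∩ {t, z, z, y2}).card)
    (k3 : 3 ≤ (A ∩ {t, z, z, y3}).card ∨ 3 ≤ (B ∩ {t, z, z, y3}).card) : False := by
  have e1 : t ∈ A ∧ z ∈ A ∧ y1 ∈ A ∧ t ≠ y1 := by
    have := three_mem_of_three_le_card_inter _ _ _ _ _ k1
    grind
  have e2 : y2 ∈ A ∧ t ≠ y2 := by
    have := three_mem_of_three_le_card_inter _ _ _ _ _ k2
    grind
  have f1 := hf y1
  have f2 := hf y2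
  have f3 := hf y3
  have z1 : z ≠ y1 := by grind
  have z2 : z ≠ y2 := by grind
  have z3 : z ≠ y3 := by grind
  obtain ⟨g, hg⟩ := exists_fourth_mem A hA t z y1 e1.1 e1.2.1 e1.2.2.1 h1 e1.2.2.2 z1
  have : g = y2 := by grind
  subst this
  have e3 : t ∈ B ∧ z ∈ B ∧ y3 ∈ B ∧ t ≠ y3 := by
    rcases k3 with k3 | k3 <;> have := three_mem_of_three_le_card_inter _ _ _ _ _ k3 <;> grind
  obtain ⟨b, hb⟩ := exists_fourth_mem B hB t z y3 e3.1 e3.2.1 e3.2.2.1 h1 e3.2.2.2 z3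
  clear k1 k2 k3 hA hB
  have k4' : (a1 ∈ A ∧ b1 ∈ A ∧ a1 ≠ b1) ∨ (a1 ∈ B ∧ b1 ∈ B ∧ a1 ≠ b1) := by
    rcases k4 with k | k <;> have := three_mem_of_three_le_card_inter _ _ _ _ _ k <;> grind
  have k5' : (a2 ∈ A ∧ b2 ∈ A ∧ a2 ≠ b2) ∨ (a2 ∈ B ∧ b2 ∈ B ∧ a2 ≠ b2) := by
    rcases k5 with k | k <;> have := three_mem_of_three_le_card_inter _ _ _ _ _ k <;> grind
  clear k4 k5
  have k6' := k6.imp (three_mem_of_three_le_card_inter _ _ _ _ _)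
    (three_mem_of_three_le_card_inter _ _ _ _ _)
  clear k6 hf
  simp only [hg, hb] at *
  rcases k4' with ⟨k4, k5, k7⟩ | ⟨k4, k5, k7⟩ <;> rcases k5' with ⟨k8, k9, k10⟩ | ⟨k8, k9, k10⟩ <;>
  grind (splits := 40)

lemma false_of_labels_disjoint (A B : Finset ℕ) (hA : A.card = 4) (hB : B.card = 4)
    (x y : Fin 4 → ℕ)
    (hxy : ∀ i j, x i = y j → i = j) (hx : x.Injective) (hy : y.Injective)
    (K : ∀ i j, i ≠ j → 3 ≤ (A ∩ {x i, x j, y i, y j}).card ∨ 3 ≤ (B ∩ {x i, x j, y i, y j}).card) :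
    False := by
  have key : ∀ A : Finset ℕ, A.card = 4 → ∃ w : Fin 4 → ℕ, (∀ i, w i ≤ 2) ∧
      w 0 + w 1 + w 2 + w 3 ≤ 4 ∧
      ∀ i j, (A ∩ {x i, x j, y i, y j}).card ≤ w i + w j := by
    intro A hA
    refine ⟨fun i => (A ∩ {x i, y i}).card,
      fun i => (card_le_card inter_subset_right).trans card_le_two, ?_, ?_⟩
    · have : ((univ : Finset (Fin 4)).biUnion fun i => A ∩ {x i, y i}).card ≤ A.card :=
        card_le_card (by intro; simp +contextual)
      rw [card_biUnion, Fin.sum_univ_four, hA] at this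
      · exact this
      · intro i _ j _ hij
        change Disjoint _ _
        rw [disjoint_left]
        intro c hc hc'
        simp only [mem_inter, mem_insert, mem_singleton] at hc hc'
        have := hxy i j; have := hxy j i; have := @hx i j; have := @hy i j
        grind
    · intro i j
      refine le_trans (card_le_card ?_) (card_union_le _ _)
      intro c; simp only [mem_inter, mem_union, mem_insert, mem_singleton]; tauto
  obtain ⟨w, hw, hws, hwc⟩ := key A hA
  obtain ⟨v, hv, hvs, hvc⟩ := key B hB
  have K' : ∀ i j, i ≠ j → 3 ≤ w i + w j ∨ 3 ≤ v i + v j := fun i j h =>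
    (K i j h).imp (fun h => h.trans (hwc i j)) (fun h => h.trans (hvc i j))
  have := K' 0 1 (by decide); have := K' 0 2 (by decide); have := K' 0 3 (by decide)
  have := K' 1 2 (by decide); have := K' 1 3 (by decide); have := K' 2 3 (by decide)
  have := hw 0; have := hw 1; have := hw 2; have := hw 3
  have := hv 0; have := hv 1; have := hv 2; have := hv 3
  omega

lemma exists_two_other_indices (s k : Fin 4) (h : s ≠ k) :
    ∃ r1 r2, r1 ≠ r2 ∧ r1 ≠ s ∧ r1 ≠ k ∧ r2 ≠ s ∧ r2 ≠ k ∧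
      ∀ i, i = s ∨ i = k ∨ i = r1 ∨ i = r2 := by
  revert s k; decide

lemma false_of_exists_switch_on_shared (A B : Finset ℕ) (hA : A.card = 4) (hB : B.card = 4)
    (x y : Fin 4 → ℕ)
    (hx : x.Injective) (hy : y.Injective) (E O : Fin 4 → Prop)
    (K : ∀ p p' q', p ≠ p' → p ≠ q' → p' = q' ∨ E p' ∨ O q' →
      3 ≤ (A ∩ {x p, x p', y p, y q'}).card ∨ 3 ≤ (B ∩ {x p, x p', y p, y q'}).card)
    (s k : Fin 4) (hsk : s ≠ k) (h : x k = y s) (hE : E k) : False := by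
  obtain ⟨r1, r2, h0, h1, h2, h3, h4, -⟩ := exists_two_other_indices s k hsk
  have l1 := K s k k hsk hsk (.inl rfl)
  have l2 := K s k r1 hsk h1.symm (.inr (.inl hE))
  have l3 := K s k r2 hsk h3.symm (.inr (.inl hE))
  have l4 := K r1 k s h2 h1 (.inr (.inl hE))
  have l5 := K r2 k s h4 h3 (.inr (.inl hE))
  have l6 := K r1 r2 r2 h0 h0 (.inl rfl)
  rw [← h] at l1 l2 l3 l4 l5
  have n1 := hx.ne hsk
  have n2 := hx.ne h1.symm
  have n3 := hx.ne h3.symm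
  have n4 := hx.ne h2.symm
  have n5 := hx.ne h4.symm
  have n6 := hx.ne h0
  have n7 := hy.ne hsk
  have n8 := hy.ne h1.symm
  have n9 := hy.ne h3.symm
  have n10 := hy.ne h2.symm
  have n11 := hy.ne h4.symm
  have n12 := hy.ne h0
  rw [← h] at n7 n8 n9
  have cB := fun A B hA hB =>
    false_of_switch_triples A B hA hB (x s) (x k) (x r1) (x r2) (y k) (y r1) (y r2)
      n1 n2 n3 n4 n5 n6
      n7 n8 n9 n10 n11 n12
  have cA := cB A B hA hB l4 l5 l6
  have cC := cB B A hB hA l4.symm l5.symm l6.symm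
  have p1 : ∀ x, (x = y k ∨ x = y r2 ∨ x = y r1) ↔ (x = y k ∨ x = y r1 ∨ x = y r2) := fun x => by
    rw [or_comm (a := x = y r2)]
  have p2 : ∀ x, (x = y r1 ∨ x = y r2 ∨ x = y k) ↔ (x = y k ∨ x = y r1 ∨ x = y r2) := fun x => by
    clear * -
    tauto
  rcases id l1 with l1' | l1'
  · rcases id l2 with l2' | l2'
    · exact cA _ _ _ (fun _ => Iff.rfl) n10 n11 n12 l1' l2' l3
    · rcases id l3 with l3' | l3'
      · exact cA _ _ _ p1 n11 n10 n12.symm l1' l3' l2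
      · exact cC _ _ _ p2 n12 n10.symm n11.symm l2' l3' l1.symm
  · rcases id l2 with l2' | l2'
    · rcases id l3 with l3' | l3'
      · exact cA _ _ _ p2 n12 n10.symm n11.symm l2' l3' l1
      · exact cC _ _ _ p1 n11 n10 n12.symm l1' l3' l2.symm
    · exact cC _ _ _ (fun _ => Iff.rfl) n10 n11 n12 l1' l2' l3.symm

lemma false_of_shared_label (A B : Finset ℕ) (hA : A.card = 4) (hB : B.card = 4)
    (t z p q f p' q' : ℕ)
    (h1 : t ≠ z) (h2 : t ≠ p) (h3 : t ≠ q) (h4 : z ≠ p) (h5 : z ≠ q) (h6 : p ≠ q)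
    (h7 : z ≠ f) (h8 : z ≠ p') (h9 : z ≠ q') (h10 : f ≠ p') (h11 : f ≠ q') (h12 : p' ≠ q')
    (h13 : t ≠ f) (h14 : t ≠ p') (h15 : t ≠ q') (h16 : f ≠ p) (h17 : f ≠ q)
    (k1 : 3 ≤ (A ∩ {z, t, f, z}).card)
    (k2 : 3 ≤ (A ∩ {p, q, p', q'}).card ∨ 3 ≤ (B ∩ {p, q, p', q'}).card)
    (k3 : 3 ≤ (A ∩ {p, t, p', z}).card ∨ 3 ≤ (B ∩ {p, t, p', z}).card)
    (k4 : 3 ≤ (A ∩ {p, z, p', f}).card ∨ 3 ≤ (B ∩ {p, z, p', f}).card)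
    (k5 : 3 ≤ (A ∩ {p, t, p', f}).card ∨ 3 ≤ (B ∩ {p, t, p', f}).card)
    (k6 : 3 ≤ (A ∩ {q, t, q', z}).card ∨ 3 ≤ (B ∩ {q, t, q', z}).card)
    (k7 : 3 ≤ (A ∩ {q, z, q', f}).card ∨ 3 ≤ (B ∩ {q, z, q', f}).card)
    (k8 : 3 ≤ (A ∩ {q, t, q', f}).card ∨ 3 ≤ (B ∩ {q, t, q', f}).card)
    (k9 : 3 ≤ (A ∩ {q, t, q', p'}).card ∨ 3 ≤ (B ∩ {q, t, q', p'}).card)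
    (k10 : 3 ≤ (A ∩ {p, q, p', f}).card ∨ 3 ≤ (B ∩ {p, q, p', f}).card)
    (k11 : 3 ≤ (A ∩ {p, t, p', q'}).card ∨ 3 ≤ (B ∩ {p, t, p', q'}).card)
    (k12 : 3 ≤ (A ∩ {q, p, q', f}).card ∨ 3 ≤ (B ∩ {q, p, q', f}).card) : False := by
  have e1 : t ∈ A ∧ z ∈ A ∧ f ∈ A := by
    have := three_mem_of_three_le_card_inter _ _ _ _ _ k1
    grind
  obtain ⟨g, hg⟩ := exists_fourth_mem A hA t z f e1.1 e1.2.1 e1.2.2 h1 h13 h7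
  have tA : ∀ a b c d, 3 ≤ (A ∩ {a, b, c, d}).card → _ := three_mem_of_three_le_card_inter A
  have tB : ∀ a b c d, 3 ≤ (B ∩ {a, b, c, d}).card → _ := three_mem_of_three_le_card_inter B
  have e2 := k2.resolve_left (by intro h; have := tA _ _ _ _ h; grind)
  have e3 : ∃ h, ∀ x, x ∈ B → x = p ∨ x = q ∨ x = p' ∨ x = q' ∨ x = h := by
    have := tB _ _ _ _ e2
    rcases this with h | h | h | h
    all_goals
      obtain ⟨h, hh⟩ := exists_fourth_mem B hB _ _ _ h.1 h.2.1 h.2.2.1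
        h.2.2.2.1 h.2.2.2.2.1 h.2.2.2.2.2
      exact ⟨h, by grind⟩
  obtain ⟨h, hh⟩ := e3
  have e2' := tB _ _ _ _ e2
  clear k1 k2 e2
  by_cases gp : g = p ∨ g = p'
  · by_cases gq : g = q ∨ g = q'
    · rcases gp with rfl | rfl
      · have : g = q' := by grind
        subst this
        clear k3 k4 k5 k6 k7 k8 k9 k10
        replace k11 := k11.imp (tA _ _ _ _) (tB _ _ _ _)
        replace k12 := k12.imp (tA _ _ _ _) (tB _ _ _ _)
        clear tA tB
        grind (splits := 40)
      · have : g = q := by grind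
        subst this
        clear k3 k4 k5 k6 k7 k8 k11 k12
        replace k9 := k9.imp (tA _ _ _ _) (tB _ _ _ _)
        replace k10 := k10.imp (tA _ _ _ _) (tB _ _ _ _)
        clear tA tB
        grind (splits := 40)
    · clear k3 k4 k5 k9 k10 k11 k12
      replace k6 := k6.imp (tA _ _ _ _) (tB _ _ _ _)
      replace k7 := k7.imp (tA _ _ _ _) (tB _ _ _ _)
      replace k8 := k8.imp (tA _ _ _ _) (tB _ _ _ _)
      clear tA tB
      grind (splits := 40)
  · clear k6 k7 k8 k9 k10 k11 k12
    replace k3 := k3.imp (tA _ _ _ _) (tB _ _ _ _)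
    replace k4 := k4.imp (tA _ _ _ _) (tB _ _ _ _)
    replace k5 := k5.imp (tA _ _ _ _) (tB _ _ _ _)
    clear tA tB
    grind (splits := 40)

lemma false_of_forall_no_switch_on_shared (A B : Finset ℕ) (hA : A.card = 4) (hB : B.card = 4)
    (x y : Fin 4 → ℕ)
    (hx : x.Injective) (hy : y.Injective) (E O : Fin 4 → Prop)
    (K : ∀ p p' q', p ≠ p' → p ≠ q' → p' = q' ∨ E p' ∨ O q' →
      3 ≤ (A ∩ {x p, x p', y p, y q'}).card ∨ 3 ≤ (B ∩ {x p, x p', y p, y q'}).card)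
    (hEO : ∀ k, x k ≠ y k → E k ∨ O k)
    (hE : ∀ s k, s ≠ k → x k = y s → ¬ E k) (hO : ∀ s k, s ≠ k → x k = y s → ¬ O s)
    (s k : Fin 4) (hsk : s ≠ k) (h : x k = y s) : False := by
  obtain ⟨r1, r2, h0, h1, h2, h3, h4, hr⟩ := exists_two_other_indices s k hsk
  have n1 := hx.ne hsk
  have n2 := hx.ne h1.symm
  have n3 := hx.ne h3.symm
  have n4 := hx.ne h2.symm
  have n5 := hx.ne h4.symm
  have n6 := hx.ne h0
  have n7 := hy.ne hsk
  have n8 := hy.ne h1.symm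
  have n9 := hy.ne h3.symm
  have n10 := hy.ne h2.symm
  have n11 := hy.ne h4.symm
  have n12 := hy.ne h0
  rw [← h] at n7 n8 n9
  have Es : E s := (hEO s (by rwa [← h])).resolve_right (hO s k hsk h)
  have Ok : O k := (hEO k n7).resolve_left (hE s k hsk h)
  have m1 : ∀ j, x s ≠ y j := by
    intro j e
    by_cases hj : j = s
    · subst hj; exact n1 (by rw [e, h])
    · exact hE j s hj e Es
  have m2 : ∀ j, y k ≠ x j := by
    intro j e
    by_cases hj : j = k
    · subst hj; exact n7 e.symm
    · exact hO k j (Ne.symm hj) e.symm Ok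
  have l1 := K k s s hsk.symm hsk.symm (.inl rfl)
  have l2 := K r1 r2 r2 h0 h0 (.inl rfl)
  have l3 := K r1 s s h1 h1 (.inl rfl)
  have l4 := K r1 k k h2 h2 (.inl rfl)
  have l5 := K r1 s k h1 h2 (.inr (.inl Es))
  have l6 := K r2 s s h3 h3 (.inl rfl)
  have l7 := K r2 k k h4 h4 (.inl rfl)
  have l8 := K r2 s k h3 h4 (.inr (.inl Es))
  have l9 := K r2 s r1 h3 h0.symm (.inr (.inl Es))
  have l10 := K r1 r2 k h0 h2 (.inr (.inr Ok))
  have l11 := K r1 s r2 h1 h0 (.inr (.inl Es))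
  have l12 := K r2 r1 k h0.symm h4 (.inr (.inr Ok))
  rw [← h] at l1 l3 l6
  rcases l1 with l1 | l1
  · exact false_of_shared_label A B hA hB _ _ _ _ _ _ _ n1 n2 n3 n4 n5 n6
      n7 n8 n9 n10 n11 n12 (m1 k) (m1 r1) (m1 r2) (m2 r1) (m2 r2)
      l1 l2 l3 l4 l5 l6 l7 l8 l9 l10 l11 l12
  · exact false_of_shared_label B A hB hA _ _ _ _ _ _ _ n1 n2 n3 n4 n5 n6
      n7 n8 n9 n10 n11 n12 (m1 k) (m1 r1) (m1 r2) (m2 r1) (m2 r2)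
      l1 l2.symm l3.symm l4.symm l5.symm l6.symm l7.symm l8.symm l9.symm l10.symm l11.symm l12.symm

lemma exists_switch_card_inter_le_two (x y : Fin 4 → ℕ) (hx : x.Injective) (hy : y.Injective)
    (E O : Fin 4 → Prop) (hEO : ∀ k, x k ≠ y k → E k ∨ O k) (A B : Finset ℕ)
    (hA : A.card = 4) (hB : B.card = 4) :
    ∃ p p' q', p ≠ p' ∧ p ≠ q' ∧ (p' = q' ∨ E p' ∨ O q') ∧
      (A ∩ {x p, x p', y p, y q'}).card ≤ 2 ∧ (B ∩ {x p, x p', y p, y q'}).card ≤ 2 := by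
  by_contra! hcon
  have K : ∀ p p' q', p ≠ p' → p ≠ q' → p' = q' ∨ E p' ∨ O q' →
      3 ≤ (A ∩ {x p, x p', y p, y q'}).card ∨ 3 ≤ (B ∩ {x p, x p', y p, y q'}).card := by
    intro p p' q' h1 h2 h3
    have := hcon p p' q' h1 h2 h3
    by_contra! h
    have := this (by omega)
    omega
  by_cases ha : ∀ i j, x i = y j → i = j
  · exact false_of_labels_disjoint A B hA hB x y ha hx hy fun i j h => K i j j h h (.inl rfl)
  by_cases hE : ∀ s k, s ≠ k → x k = y s → ¬ E k
  · by_cases hO : ∀ s k, s ≠ k → x k = y s → ¬ O s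
    · push Not at ha
      obtain ⟨i, j, e, hij⟩ := ha
      exact false_of_forall_no_switch_on_shared A B hA hB x y hx hy E O K hEO hE hO j i hij.symm e
    · push Not at hO
      obtain ⟨s, k, h1, h2, h3⟩ := hO
      refine false_of_exists_switch_on_shared A B hA hB y x hy hx O E ?_ k s h1.symm h2.symm h3
      intro p p' q' g1 g2 g3
      have e : ({y p, y p', x p, x q'} : Finset ℕ) = {x p, x q', y p, y p'} := by ext; simp; tauto
      rw [e]
      exact K p q' p' g2 g1 (by tauto)
  · push Not at hE
    obtain ⟨s, k, h1, h2, h3⟩ := hE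
    exact false_of_exists_switch_on_shared A B hA hB x y hx hy E O K s k h1 h2 h3

lemma exists_token_labelling (S : ℕ → Finset ℕ) (hS : ∀ i, (S i).card = 4) :
    ∃ g : ℕ → Fin 4 → ℕ, (∀ i, (g i).Injective) ∧ (∀ i k, g i k ∈ S i) ∧
      ∀ i k, g i k ∈ S (i + 1) → g (i + 1) k = g i k := by
  have step : ∀ (T : Finset ℕ) (hT : T.card = 4) (f : {f : Fin 4 → ℕ // f.Injective}),
      ∃ f' : {f : Fin 4 → ℕ // f.Injective}, (∀ k, f'.1 k ∈ T) ∧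
        ∀ k, f.1 k ∈ T → f'.1 k = f.1 k := by
    intro T hT f
    obtain ⟨e, he⟩ := Finset.exists_equiv_extend_of_card_eq (t := T) (α := Fin 4)
      (s := univ.filter fun k => f.1 k ∈ T) (f := f.1) (by simp [hT])
      (by intro c; simp +contextual [eq_comm]) (f.2.injOn)
    exact ⟨⟨fun k => e k, fun k l h => e.injective (Subtype.ext h)⟩, fun k => (e k).2,
      fun k hk => he k (by simpa using hk)⟩
  choose F hF hF' using fun i => step (S i) (hS i)
  let G : ℕ → {f : Fin 4 → ℕ // f.Injective} := fun i =>
    Nat.rec (F 0 ⟨fun k => k, Fin.val_injective⟩) (fun i f => F (i + 1) f) i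
  refine ⟨fun i => (G i).1, fun i => (G i).2, ?_, fun i k => hF' (i + 1) (G i) k⟩
  rintro (_ | i) k
  · exact hF _ _ _
  · exact hF _ _ _

lemma exists_path_coloring (S : ℕ → Finset ℕ) (hS : ∀ i, (S i).card = 4) (n : ℕ) (hn : Even n)
    (A B : Finset ℕ) (hA : A.card = 4) (hB : B.card = 4) :
    ∃ C : ℕ → Finset ℕ, (∀ i, C i ⊆ S i) ∧ (∀ i, (C i).card = 2) ∧
      (∀ i < n, Disjoint (C i) (C (i + 1))) ∧
      (A ∩ (C 0 ∪ C n)).card ≤ 2 ∧ (B ∩ (C 0 ∪ C n)).card ≤ 2 := by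
  obtain ⟨g, hg, hgS, hstep⟩ := exists_token_labelling S hS
  have hkl : ∀ i k l, g i k = g (i + 1) l → k = l := by
    intro i k l h
    have := hstep i k (h ▸ hgS (i + 1) l)
    exact hg (i + 1) (this.trans h)
  have hEO : ∀ k, g 0 k ≠ g n k → (∃ i < n, Even i ∧ g i k ≠ g (i + 1) k) ∨
      ∃ i < n, Odd i ∧ g i k ≠ g (i + 1) k := by
    intro k hk
    by_contra! h
    apply hk
    have : ∀ i ≤ n, g 0 k = g i k := by
      intro i
      induction i with
      | zero => simp
      | succ i ih =>
        intro hi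
        rw [ih (by omega)]
        rcases Nat.even_or_odd i with h' | h'
        · exact h.1 i (by omega) h'
        · exact h.2 i (by omega) h'
    exact this n le_rfl
  obtain ⟨p, p', q', h1, h2, h3, hA', hB'⟩ :=
    exists_switch_card_inter_le_two (g 0) (g n) (hg 0) (hg n) _ _ hEO A B hA hB
  obtain ⟨m, hm⟩ : ∃ m, p' = q' ∨ (m < n ∧ Even m ∧ g m p' ≠ g (m + 1) p') ∨
      (m < n ∧ Odd m ∧ g m q' ≠ g (m + 1) q') := by
    rcases h3 with h | ⟨m, h⟩ | ⟨m, h⟩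
    · exact ⟨0, .inl h⟩
    · exact ⟨m, .inr (.inl h)⟩
    · exact ⟨m, .inr (.inr h)⟩
  let T : ℕ → Finset (Fin 4) := fun i => if i ≤ m then {p, p'} else {p, q'}
  have hT : ∀ i, (T i).card = 2 := by
    intro i
    by_cases h : i ≤ m <;> simp [T, h, h1, h2]
  have hTe : ∀ i < n, Even i → ∀ k, g i k = g (i + 1) k → k ∈ T i → k ∈ T (i + 1) := by
    clear hEO hkl hstep hA' hB' hT h3
    intro i hi he k hk hkT
    have he' : ¬ Odd i := Nat.not_odd_iff_even.2 he
    by_cases him : i = m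
    · subst him
      simp only [T, le_refl, if_true, mem_insert, mem_singleton] at hkT
      simp only [T, Nat.not_succ_le_self, if_false, mem_insert, mem_singleton]
      grind
    · simp only [T, show i + 1 ≤ m ↔ i ≤ m by omega]
      exact hkT
  have hTo : ∀ i < n, Odd i → ∀ k, g i k = g (i + 1) k → k ∈ T (i + 1) → k ∈ T i := by
    clear hEO hkl hstep hA' hB' hT h3
    intro i hi he k hk hkT
    have he' : ¬ Even i := Nat.not_even_iff_odd.2 he
    by_cases him : i = m
    · subst him
      simp only [T, Nat.not_succ_le_self, if_false, mem_insert, mem_singleton] at hkT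
      simp only [T, le_refl, if_true, mem_insert, mem_singleton]
      grind
    · simp only [T, show i + 1 ≤ m ↔ i ≤ m by omega] at hkT
      exact hkT
  let U : ℕ → Finset (Fin 4) := fun i => if Even i then T i else (T i)ᶜ
  have hU : ∀ i, (U i).card = 2 := by
    intro i
    by_cases h : Even i <;> simp [U, h, hT, card_compl]
  have h0 : (U 0).image (g 0) = {g 0 p, g 0 p'} := by simp [U, T]
  have hn' : (U n).image (g n) = {g n p, g n q'} := by
    by_cases h : n ≤ m
    · have : p' = q' := by
        rcases hm with hm | hm | hm
        · exact hm
        · omega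
        · omega
      simp [U, T, hn, this]
    · simp [U, T, hn, h]
  have hun : ({g 0 p, g 0 p'} ∪ {g n p, g n q'} : Finset ℕ) = {g 0 p, g 0 p', g n p, g n q'} := by
    ext; simp; tauto
  refine ⟨fun i => (U i).image (g i), ?_, ?_, ?_, ?_, ?_⟩
  · intro i c hc
    obtain ⟨k, -, rfl⟩ := mem_image.1 hc
    exact hgS i k
  · intro i
    rw [card_image_of_injective _ (hg i), hU]
  · intro i hi
    rw [disjoint_left]
    intro c hc hc'
    obtain ⟨k, hk, rfl⟩ := mem_image.1 hc
    obtain ⟨l, hl, hlk⟩ := mem_image.1 hc'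
    obtain rfl := hkl i k l hlk.symm
    by_cases h' : Even i
    · have e : ¬ Even (i + 1) := by simpa [Nat.even_add_one] using h'
      simp only [U, h', e, if_true, if_false, mem_compl] at hk hl
      exact hl (hTe i hi h' k hlk.symm hk)
    · have e : Even (i + 1) := by simpa [Nat.even_add_one] using h'
      simp only [U, h', e, if_true, if_false, mem_compl] at hk hl
      exact hk (hTo i hi (Nat.not_even_iff_odd.1 h') k hlk.symm hl)
  · simpa only [h0, hn', hun] using hA'
  · simpa only [h0, hn', hun] using hB'

lemma exists_extension_along_parent {V α : Type*} (p : V → V) (d : V → ℕ) (Z : Set V) (f₀ : V → α)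
    (hd : ∀ x ∉ Z, d (p x) < d x) (R : V → α → α → Prop) (hR : ∀ x c, ∃ c', R x c c') :
    ∃ f : V → α, (∀ x ∈ Z, f x = f₀ x) ∧ ∀ x ∉ Z, R x (f (p x)) (f x) := by
  classical
  choose F hF using hR
  let f : ℕ → V → α := fun n =>
    Nat.rec f₀ (fun _ g x => if x ∈ Z then f₀ x else F x (g (p x))) n
  have hf : ∀ n x, f (n + 1) x = if x ∈ Z then f₀ x else F x (f n (p x)) := fun _ _ => rfl
  have stable : ∀ n m x, d x < n → d x < m → f n x = f m x := by
    intro n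
    induction n with
    | zero => intro m x h; omega
    | succ n ih =>
      rintro (_ | m) x h h'
      · omega
      · rw [hf, hf]
        split_ifs with hx
        · rfl
        · have := hd x hx
          rw [ih m (p x) (by omega) (by omega)]
  refine ⟨fun x => f (d x + 1) x, fun x hx => by simp [hf, hx], fun x hx => ?_⟩
  have := hd x hx
  simp only [hf (d x), hx, if_false]
  rw [stable (d (p x) + 1) (d x) (p x) (by omega) (by omega)]
  exact hF _ _

lemma choosable_four_two_of_parent {V : Type*} (G : SimpleGraph V) (u w a b : V)
    (hua : u ≠ a) (hub : u ≠ b) (hwa : w ≠ a) (hwb : w ≠ b)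
    (hNa : ∀ x, G.Adj a x → x = u ∨ x = w) (hNb : ∀ x, G.Adj b x → x = u ∨ x = w)
    (p : V → V) (d : V → ℕ)
    (hp : ∀ x, x ≠ a → x ≠ b → x ≠ u → p x ≠ a ∧ p x ≠ b ∧ G.Adj x (p x) ∧ d (p x) < d x)
    (hedge : ∀ x y, G.Adj x y → x ≠ a → x ≠ b → y ≠ a → y ≠ b →
      (x ≠ u ∧ p x = y) ∨ (y ≠ u ∧ p y = x))
    (col : V → Bool) (hcol : ∀ x y, G.Adj x y → col x ≠ col y) (huw : col u = col w) :
    G.Choosable 4 2 := by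
  classical
  intro S hS
  have hgood : ∀ i, (∀ j < i, p^[j] w ≠ u) → p^[i] w ≠ a ∧ p^[i] w ≠ b ∧ i + d (p^[i] w) ≤ d w ∧
      (Even i ↔ col (p^[i] w) = col w) := by
    intro i
    induction i with
    | zero => intro _; simp [hwa, hwb]
    | succ i ih =>
      intro h
      obtain ⟨h1, h2, h3, h4⟩ := ih fun j hj => h j (by omega)
      rw [Function.iterate_succ_apply']
      obtain ⟨g1, g2, g3, g4⟩ := hp _ h1 h2 (h i (by omega))
      refine ⟨g1, g2, by omega, ?_⟩
      rw [Nat.even_add_one, h4]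
      have := hcol _ _ g3
      revert this
      generalize col (p (p^[i] w)) = x
      generalize col (p^[i] w) = y
      generalize col w = z
      revert x y z
      decide
  have hex : ∃ n, p^[n] w = u := by
    by_contra! h
    have := hgood (d w + 1) fun j _ => h j
    omega
  obtain ⟨n, hn, hmin⟩ : ∃ n, p^[n] w = u ∧ ∀ j < n, p^[j] w ≠ u :=
    ⟨Nat.find hex, Nat.find_spec hex, fun j hj => Nat.find_min hex hj⟩
  have hgood' : ∀ i ≤ n, p^[i] w ≠ a ∧ p^[i] w ≠ b := fun i hi =>
    ⟨(hgood i fun j hj => hmin j (by omega)).1, (hgood i fun j hj => hmin j (by omega)).2.1⟩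
  have hinj : ∀ i j, i < j → j ≤ n → p^[i] w ≠ p^[j] w := by
    have hdec : ∀ k i, i + k + 1 ≤ n → d (p^[i + k + 1] w) < d (p^[i] w) := by
      intro k i hik
      induction k with
      | zero =>
        rw [add_zero, Function.iterate_succ_apply']
        exact (hp _ (hgood' i (by omega)).1 (hgood' i (by omega)).2 (hmin i (by omega))).2.2.2
      | succ k ih =>
        refine lt_trans ?_ (ih (by omega))
        rw [← add_assoc, Function.iterate_succ_apply']
        exact (hp _ (hgood' _ (by omega)).1 (hgood' _ (by omega)).2 (hmin _ (by omega))).2.2.2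
    intro i j hij hj h
    have := hdec (j - i - 1) i (by omega)
    rw [show i + (j - i - 1) + 1 = j by omega, h] at this
    exact lt_irrefl _ this
  have hinj' : ∀ i j, i ≤ n → j ≤ n → p^[i] w = p^[j] w → i = j := by
    intro i j hi hj h
    rcases lt_trichotomy i j with h' | h' | h'
    · exact absurd h (hinj i j h' hj)
    · exact h'
    · exact absurd h.symm (hinj j i h' hi)
  have heven : Even n := (hgood n hmin).2.2.2.2 (by rw [hn, huw])
  obtain ⟨C, hCS, hC2, hCd, hCa, hCb⟩ :=
    exists_path_coloring (fun i => S (p^[i] w)) (fun i => hS _) n heven (S a) (S b) (hS a) (hS b)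
  have pick : ∀ A X : Finset ℕ, A.card = 4 → (A ∩ X).card ≤ 2 → ∃ D ⊆ A \ X, D.card = 2 := by
    intro A X hA hX
    apply exists_subset_card_eq
    have := card_sdiff_add_card_inter A X
    omega
  obtain ⟨Ca, hCaS, hCa2⟩ := pick _ _ (hS a) hCa
  obtain ⟨Cb, hCbS, hCb2⟩ := pick _ _ (hS b) hCb
  let f₀ : V → Finset ℕ := fun x => if h : ∃ i ≤ n, p^[i] w = x then C h.choose else
    if x = a then Ca else Cb
  have hf₀ : ∀ i ≤ n, f₀ (p^[i] w) = C i := by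
    intro i hi
    have h : ∃ j ≤ n, p^[j] w = p^[i] w := ⟨i, hi, rfl⟩
    simp only [f₀, h, dif_pos]
    rw [hinj' _ _ h.choose_spec.1 hi h.choose_spec.2]
  have hf₀a : f₀ a = Ca := by
    have h : ¬ ∃ i ≤ n, p^[i] w = a := by
      rintro ⟨i, hi, h⟩
      exact (hgood' i hi).1 h
    simp only [f₀, h, dif_neg, not_false_eq_true, if_true]
  have hf₀b : a ≠ b → f₀ b = Cb := by
    intro hab
    have h : ¬ ∃ i ≤ n, p^[i] w = b := by
      rintro ⟨i, hi, h⟩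
      exact (hgood' i hi).2 h
    simp only [f₀, h, dif_neg, not_false_eq_true, hab.symm, if_false]
  let Z : Set V := {x | x = a ∨ x = b ∨ ∃ i ≤ n, p^[i] w = x}
  have huZ : u ∈ Z := .inr (.inr ⟨n, le_rfl, hn⟩)
  obtain ⟨f, hfZ, hfR⟩ := exists_extension_along_parent p d Z f₀
    (by
      intro x hx
      have hxu : x ≠ u := fun h => hx (h ▸ huZ)
      exact (hp x (fun h => hx (.inl h)) (fun h => hx (.inr (.inl h))) hxu).2.2.2)
    (fun x c c' => c.card = 2 → c' ⊆ S x ∧ c'.card = 2 ∧ Disjoint c' c)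
    (by
      intro x c
      by_cases hc : c.card = 2
      · obtain ⟨c', h1, h2⟩ := pick (S x) c (hS x) (hc ▸ card_le_card inter_subset_right)
        exact ⟨c', fun _ => ⟨h1.trans sdiff_subset, h2, disjoint_sdiff.symm.mono_left h1⟩⟩
      · exact ⟨c, fun h => absurd h hc⟩)
  have hfi : ∀ i ≤ n, f (p^[i] w) = C i := fun i hi => by
    rw [hfZ _ (.inr (.inr ⟨i, hi, rfl⟩)), hf₀ i hi]
  have hfu : f u = C n := by rw [← hfi n le_rfl, hn]
  have hfw : f w = C 0 := hfi 0 (Nat.zero_le _)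
  have hfa : f a = Ca := by rw [hfZ _ (.inl rfl), hf₀a]
  have hfb : f b ⊆ S b \ (C 0 ∪ C n) ∧ (f b).card = 2 := by
    by_cases hab : a = b
    · subst hab; rw [hfa]; exact ⟨hCaS, hCa2⟩
    · rw [hfZ _ (.inr (.inl rfl)), hf₀b hab]; exact ⟨hCbS, hCb2⟩
  have hall : ∀ N x, d x < N → f x ⊆ S x ∧ (f x).card = 2 := by
    intro N
    induction N with
    | zero => intro x hx; omega
    | succ N ih =>
      intro x hx
      by_cases hxZ : x ∈ Z
      · rcases hxZ with rfl | rfl | ⟨i, hi, rfl⟩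
        · rw [hfa]; exact ⟨hCaS.trans sdiff_subset, hCa2⟩
        · exact ⟨hfb.1.trans sdiff_subset, hfb.2⟩
        · rw [hfi i hi]; exact ⟨hCS i, hC2 i⟩
      · have hxu : x ≠ u := fun h => hxZ (h ▸ huZ)
        have := (hp x (fun h => hxZ (.inl h)) (fun h => hxZ (.inr (.inl h))) hxu).2.2.2
        have := hfR x hxZ (ih (p x) (by omega)).2
        exact ⟨this.1, this.2.1⟩
  have hall' := fun x => hall (d x + 1) x (Nat.lt_succ_self _)
  have hpar : ∀ x, x ≠ a → x ≠ b → x ≠ u → Disjoint (f x) (f (p x)) := by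
    intro x hxa hxb hxu
    by_cases hxZ : x ∈ Z
    · rcases hxZ with h | h | ⟨i, hi, rfl⟩
      · exact absurd h hxa
      · exact absurd h hxb
      · have : i < n := lt_of_le_of_ne hi fun h => hxu (h ▸ hn)
        rw [hfi i hi, ← Function.iterate_succ_apply' p, hfi (i + 1) this]
        exact hCd i this
    · exact (hfR x hxZ (hall' _).2).2.2
  have hda : ∀ y, G.Adj a y → Disjoint (f a) (f y) := by
    intro y hy
    have : Disjoint (f a) (C 0 ∪ C n) := by rw [hfa]; exact disjoint_sdiff.symm.mono_left hCaS
    rw [disjoint_union_right] at this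
    rcases hNa y hy with rfl | rfl
    · rw [hfu]; exact this.2
    · rw [hfw]; exact this.1
  have hdb : ∀ y, G.Adj b y → Disjoint (f b) (f y) := by
    intro y hy
    have : Disjoint (f b) (C 0 ∪ C n) := disjoint_sdiff.symm.mono_left hfb.1
    rw [disjoint_union_right] at this
    rcases hNb y hy with rfl | rfl
    · rw [hfu]; exact this.2
    · rw [hfw]; exact this.1
  refine ⟨f, fun x => (hall' x).1, fun x => (hall' x).2, fun x y hxy => ?_⟩
  by_cases hxa : x = a
  · subst hxa; exact hda y hxy
  by_cases hxb : x = b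
  · subst hxb; exact hdb y hxy
  by_cases hya : y = a
  · subst hya; exact (hda x hxy.symm).symm
  by_cases hyb : y = b
  · subst hyb; exact (hdb x hxy.symm).symm
  rcases hedge x y hxy hxa hxb hya hyb with ⟨h, rfl⟩ | ⟨h, rfl⟩
  · exact hpar x hxa hxb h
  · exact (hpar y hya hyb h).symm

end

namespace SimpleGraph

variable {V : Type*} {G : SimpleGraph V}

/-- `c` is a proper colouring of `G` by natural numbers. -/
def IsProper (G : SimpleGraph V) (c : V → ℕ) : Prop :=
  ∀ x y, G.Adj x y → c x ≠ c y

lemma Choosable.exists_isProper (h : G.Choosable 2 1) (L : V → Finset ℕ)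
    (hL : ∀ v, (L v).card = 2) : ∃ c, G.IsProper c ∧ ∀ v, c v ∈ L v := by
  obtain ⟨C, hC, hC1, hd⟩ := h L hL
  choose c hc using fun v => Finset.card_eq_one.1 (hC1 v)
  refine ⟨c, fun x y hxy e => ?_, fun v => hC v (by simp [hc])⟩
  have := hd x y hxy
  rw [hc, hc, e] at this
  simp at this

lemma Choosable.exists_isProper_of_pairwise_disjoint (h : G.Choosable 2 1) {ι : Type*}
    (K : ι → Set V) (hK : ∀ i j x, x ∈ K i → x ∈ K j → i = j) (L : ι → V → Finset ℕ)
    (hL : ∀ i, ∀ x ∈ K i, (L i x).card = 2) (L₀ : V → Finset ℕ) (hL₀ : ∀ v, (L₀ v).card = 2) :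
    ∃ c, G.IsProper c ∧ (∀ i, ∀ x ∈ K i, c x ∈ L i x) ∧ ∀ x, (∀ i, x ∉ K i) → c x ∈ L₀ x := by
  classical
  obtain ⟨c, hc, hcL⟩ := h.exists_isProper
    (fun x => if hx : ∃ i, x ∈ K i then L hx.choose x else L₀ x) (by
      intro x
      split_ifs with hx
      · exact hL _ x hx.choose_spec
      · exact hL₀ x)
  refine ⟨c, hc, fun i x hx => ?_, fun x hx => ?_⟩
  · have hx' : ∃ i, x ∈ K i := ⟨i, hx⟩
    have := hcL x
    rw [dif_pos hx', hK _ _ x hx'.choose_spec hx] at this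
    exact this
  · have := hcL x
    rwa [dif_neg (by push Not; exact hx)] at this

/-- Every colour at `v` can be excluded by suitable lists of size two on `K`. -/
def Dead (G : SimpleGraph V) (K : Set V) (v : V) : Prop :=
  ∀ p : ℕ, ∃ L : V → Finset ℕ, (∀ x ∈ K, (L x).card = 2) ∧
    ∀ c, G.IsProper c → (∀ x ∈ K, c x ∈ L x) → c v ≠ p

/-- The pair of colours `(p, r)` at `(u, w)` can be excluded by suitable lists of size two
on `K`. -/
def Excludes (G : SimpleGraph V) (K : Set V) (u w : V) (p r : ℕ) : Prop :=
  ∃ L : V → Finset ℕ, (∀ x ∈ K, (L x).card = 2) ∧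
    ∀ c, G.IsProper c → (∀ x ∈ K, c x ∈ L x) → ¬ (c u = p ∧ c w = r)

/-- Every pair of colours at `(u, w)` can be excluded by lists on `K`. -/
def StrongLink (G : SimpleGraph V) (K : Set V) (u w : V) : Prop :=
  ∀ p r, G.Excludes K u w p r

/-- Every pair of distinct colours at `(u, w)` can be excluded by lists on `K`. -/
def WeakLink (G : SimpleGraph V) (K : Set V) (u w : V) : Prop :=
  ∀ p r, p ≠ r → G.Excludes K u w p r

/-- A colouring of `K`, `u` and `w` from two colours behaves at `(u, w)` like `col`. -/
def ParityLink (G : SimpleGraph V) (col : V → Bool) (K : Set V) (u w : V) : Prop :=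
  ∀ c, G.IsProper c → (∀ x ∈ K, c x = 1 ∨ c x = 2) → (c u = 1 ∨ c u = 2) →
    (c w = 1 ∨ c w = 2) → (c u = c w ↔ col u = col w)

lemma Excludes.symm {K : Set V} {u w : V} {p r : ℕ} (h : G.Excludes K u w p r) :
    G.Excludes K w u r p := by
  obtain ⟨L, hL, h⟩ := h
  exact ⟨L, hL, fun c hc hcL e => h c hc hcL e.symm⟩

lemma StrongLink.symm {K : Set V} {u w : V} (h : G.StrongLink K u w) : G.StrongLink K w u :=
  fun p r => (h r p).symm

lemma WeakLink.symm {K : Set V} {u w : V} (h : G.WeakLink K u w) : G.WeakLink K w u :=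
  fun p r hpr => (h r p hpr.symm).symm

lemma ParityLink.symm {col : V → Bool} {K : Set V} {u w : V} (h : G.ParityLink col K u w) :
    G.ParityLink col K w u :=
  fun c hc hK hw hu => by rw [eq_comm, h c hc hK hu hw, eq_comm]

lemma Choosable.false_of_dead (h : G.Choosable 2 1) {K₁ K₂ : Set V} {v : V} (h₁ : G.Dead K₁ v)
    (h₂ : G.Dead K₂ v) (hv₁ : v ∉ K₁) (hv₂ : v ∉ K₂) (hd : Disjoint K₁ K₂) : False := by
  obtain ⟨L₁, hL₁, hc₁⟩ := h₁ 1
  obtain ⟨L₂, hL₂, hc₂⟩ := h₂ 2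
  rw [Set.disjoint_left] at hd
  obtain ⟨c, hc, hcK, hc0⟩ := h.exists_isProper_of_pairwise_disjoint ![K₁, K₂]
    (by
      intro i j x
      fin_cases i <;> fin_cases j <;> simp +contextual
      · exact fun h h' => hd h h'
      · exact fun h h' => hd h' h) ![L₁, L₂]
    (by intro i; fin_cases i <;> simpa) (fun _ => {1, 2}) (by simp)
  have hv := hc0 v (by intro i; fin_cases i <;> simpa)
  simp only [Finset.mem_insert, Finset.mem_singleton] at hv
  rcases hv with hv | hv
  · exact hc₁ c hc (hcK 0) hv
  · exact hc₂ c hc (hcK 1) hv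

lemma Choosable.false_of_strongLink (h : G.Choosable 2 1) {col : V → Bool} {K₁ K₂ K₃ : Set V}
    {u w : V} (h₁ : G.ParityLink col K₁ u w) (h₂ : G.StrongLink K₂ u w)
    (h₃ : G.StrongLink K₃ u w) (hu : u ∉ K₁ ∧ u ∉ K₂ ∧ u ∉ K₃) (hw : w ∉ K₁ ∧ w ∉ K₂ ∧ w ∉ K₃)
    (h₁₂ : Disjoint K₁ K₂) (h₁₃ : Disjoint K₁ K₃) (h₂₃ : Disjoint K₂ K₃) : False := by
  classical
  have key : ∃ p r q s : ℕ, ∀ c, G.IsProper c → (∀ x ∈ K₁, c x = 1 ∨ c x = 2) →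
      (c u = 1 ∨ c u = 2) → (c w = 1 ∨ c w = 2) → (c u = p ∧ c w = r) ∨ (c u = q ∧ c w = s) := by
    by_cases e : col u = col w
    · refine ⟨1, 1, 2, 2, fun c hc hK hcu hcw => ?_⟩
      have := (h₁ c hc hK hcu hcw).2 e
      omega
    · refine ⟨1, 2, 2, 1, fun c hc hK hcu hcw => ?_⟩
      have := mt (h₁ c hc hK hcu hcw).1 e
      omega
  obtain ⟨p, r, q, s, key⟩ := key
  obtain ⟨L₂, hL₂, hc₂⟩ := h₂ p r
  obtain ⟨L₃, hL₃, hc₃⟩ := h₃ q s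
  rw [Set.disjoint_left] at h₁₂ h₁₃ h₂₃
  obtain ⟨c, hc, hcK, hc0⟩ := h.exists_isProper_of_pairwise_disjoint ![K₂, K₃]
    (by
      intro i j x
      fin_cases i <;> fin_cases j <;> simp +contextual
      · exact fun h h' => h₂₃ h h'
      · exact fun h h' => h₂₃ h' h) ![L₂, L₃]
    (by intro i; fin_cases i <;> simpa) (fun _ => {1, 2}) (by simp)
  have hc0' : ∀ x, x ∉ K₂ → x ∉ K₃ → c x = 1 ∨ c x = 2 := by
    intro x h2 h3
    simpa using hc0 x (by intro i; fin_cases i <;> simpa)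
  rcases key c hc (fun x hx => hc0' x (h₁₂ hx) (h₁₃ hx)) (hc0' u hu.2.1 hu.2.2)
    (hc0' w hw.2.1 hw.2.2) with h | h
  · exact hc₂ c hc (hcK 0) h
  · exact hc₃ c hc (hcK 1) h

lemma Choosable.false_of_weakLink (h : G.Choosable 2 1) (K : Fin 4 → Set V) {u w : V}
    (huw : u ≠ w) (hL : ∀ i, G.WeakLink (K i) u w) (hu : ∀ i, u ∉ K i) (hw : ∀ i, w ∉ K i)
    (hK : ∀ i j x, x ∈ K i → x ∈ K j → i = j) : False := by
  classical
  have h1 := hL 0 1 3 (by decide)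
  have h2 := hL 1 1 4 (by decide)
  have h3 := hL 2 2 3 (by decide)
  have h4 := hL 3 2 4 (by decide)
  obtain ⟨L₁, hL₁, hc₁⟩ := h1
  obtain ⟨L₂, hL₂, hc₂⟩ := h2
  obtain ⟨L₃, hL₃, hc₃⟩ := h3
  obtain ⟨L₄, hL₄, hc₄⟩ := h4
  obtain ⟨c, hc, hcK, hc0⟩ := h.exists_isProper_of_pairwise_disjoint K hK ![L₁, L₂, L₃, L₄]
    (by intro i; fin_cases i <;> simpa) (fun x => if x = u then {1, 2} else {3, 4})
    (by intro v; split_ifs <;> rfl)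
  have hcu : c u = 1 ∨ c u = 2 := by simpa using hc0 u hu
  have hcw : c w = 3 ∨ c w = 4 := by simpa [huw.symm] using hc0 w hw
  rcases hcu with hcu | hcu <;> rcases hcw with hcw | hcw
  · exact hc₁ c hc (hcK 0) ⟨hcu, hcw⟩
  · exact hc₂ c hc (hcK 1) ⟨hcu, hcw⟩
  · exact hc₃ c hc (hcK 2) ⟨hcu, hcw⟩
  · exact hc₄ c hc (hcK 3) ⟨hcu, hcw⟩

/-- The parent function `p` makes `K ∪ {v}` a tree of edges of `G` with root `v ∉ K`; the rank
`d` decreases towards the root. -/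
structure IsRootedTree (G : SimpleGraph V) (K : Set V) (v : V) (p : V → V) (d : V → ℕ) :
    Prop where
  notMem : v ∉ K
  parent_mem : ∀ x ∈ K, p x = v ∨ p x ∈ K
  adj : ∀ x ∈ K, G.Adj x (p x)
  lt : ∀ x ∈ K, d (p x) < d x

namespace IsRootedTree

variable {K : Set V} {v : V} {p : V → V} {d : V → ℕ}

lemma induction (h : G.IsRootedTree K v p d) (P : V → Prop) (hv : P v)
    (hP : ∀ x ∈ K, P (p x) → P x) : ∀ x ∈ K, P x := by
  have : ∀ n, ∀ x ∈ K, d x < n → P x := by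
    intro n
    induction n with
    | zero => intro x _ h; omega
    | succ n ih =>
      intro x hx hd
      have := h.lt x hx
      rcases h.parent_mem x hx with h' | h'
      · exact hP x hx (h' ▸ hv)
      · exact hP x hx (ih _ h' (by omega))
  exact fun x hx => this _ x hx (Nat.lt_succ_self _)

lemma forced (h : G.IsRootedTree K v p d) (φ : V → ℕ) {c : V → ℕ} (hc : G.IsProper c)
    (hcL : ∀ x ∈ K, c x ∈ ({φ (p x), φ x} : Finset ℕ)) (hv : c v = φ v) :
    ∀ x ∈ K, c x = φ x := by
  refine h.induction _ hv fun x hx ih => ?_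
  have h1 := hc _ _ (h.adj x hx)
  have h2 := hcL x hx
  simp only [Finset.mem_insert, Finset.mem_singleton] at h2
  rw [ih] at h1
  tauto

lemma dead [Finite V] (h : G.IsRootedTree K v p d) {x y : V} (hxy : G.Adj x y) (hy : y ∈ K)
    (hx : x = v ∨ x ∈ K) (hpy : p y ≠ x) (hpx : x ∈ K → p x ≠ y) : G.Dead K v := by
  classical
  intro r
  obtain ⟨n, ⟨e⟩⟩ := Finite.exists_equiv_fin V
  let φ₀ : V → ℕ := fun z => if z = v then r else e z + r + 1
  have hφ₀ : φ₀.Injective := by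
    intro z z' hz
    simp only [φ₀] at hz
    split_ifs at hz with h1 h2 h2
    · exact h1.trans h2.symm
    · omega
    · omega
    · exact e.injective (Fin.ext (by omega))
  have hyv : v ≠ y := fun e => h.notMem (e ▸ hy)
  let τ : V → V := fun z => if z = y then x else z
  have hτ : ∀ z ∈ K, τ z ≠ τ (p z) := by
    intro z hz
    have hne := (h.adj z hz).ne
    simp only [τ]
    split_ifs with h1 h2 h2
    · exact absurd (h1.trans h2.symm) hne
    · subst h1; exact hpy.symm
    · rintro rfl; exact hpx hz h2
    · exact hne
  refine ⟨fun z => {φ₀ (τ (p z)), φ₀ (τ z)}, fun z hz => Finset.card_pair (hφ₀.ne (hτ z hz).symm),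
    fun c hc hcL hcv => ?_⟩
  have hv : c v = φ₀ (τ v) := by simp [τ, φ₀, hyv, hcv]
  have hf := h.forced (fun z => φ₀ (τ z)) hc hcL hv
  have hcx : c x = φ₀ (τ x) := by
    rcases hx with rfl | hx
    · exact hv
    · exact hf x hx
  apply hc x y hxy
  rw [hf y hy, hcx]
  simp [τ]

lemma excludes [Finite V] (h : G.IsRootedTree K v p d) {w y : V} (hyw : G.Adj y w)
    (hy : y ∈ K) {r s : ℕ} (hrs : p y ≠ v ∨ r ≠ s) : G.Excludes K v w r s := by
  classical
  obtain ⟨n, ⟨e⟩⟩ := Finite.exists_equiv_fin V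
  have hyv : y ≠ v := fun e => h.notMem (e ▸ hy)
  let φ : V → ℕ := fun z => if z = v then r else if z = y then s else e z + r + s + 1
  have hφ : ∀ z ∈ K, φ z ≠ φ (p z) := by
    intro z hz
    have hne := (h.adj z hz).ne
    have hzv : z ≠ v := fun e => h.notMem (e ▸ hz)
    have he : (e z : ℕ) ≠ e (p z) := fun h => hne (e.injective (Fin.ext h))
    simp only [φ]
    grind
  refine ⟨fun z => {φ (p z), φ z}, fun z hz => Finset.card_pair (hφ z hz).symm, ?_⟩
  rintro c hc hcL ⟨hcv, hcw⟩
  have := h.forced φ hc hcL (by simp [φ, hcv]) y hy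
  exact hc y w hyw (by simp [this, φ, hyv, hcw])

lemma strongLink [Finite V] (h : G.IsRootedTree K v p d) {w y : V} (hyw : G.Adj y w)
    (hy : y ∈ K) (hpy : p y ≠ v) : G.StrongLink K v w :=
  fun _ _ => h.excludes hyw hy (.inl hpy)

lemma weakLink [Finite V] (h : G.IsRootedTree K v p d) {w y : V} (hyw : G.Adj y w)
    (hy : y ∈ K) : G.WeakLink K v w :=
  fun _ _ hrs => h.excludes hyw hy (.inr hrs)

lemma parityLink (h : G.IsRootedTree K v p d) {col : V → Bool}
    (hcol : ∀ x y, G.Adj x y → col x ≠ col y) {w y : V} (hyw : G.Adj y w) (hy : y ∈ K) :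
    G.ParityLink col K v w := by
  intro c hc hK hv hw
  have step : ∀ x z, G.Adj x z → (c x = 1 ∨ c x = 2) → (c z = 1 ∨ c z = 2) →
      (c v = c z ↔ col v = col z) → (c v = c x ↔ col v = col x) := by
    intro x z hxz hx hz ih
    have h1 := hc x z hxz
    have h2 : col v = col z ↔ ¬ col v = col x := by
      have := hcol x z hxz
      revert this
      generalize col x = i
      generalize col v = j
      generalize col z = k
      revert i j k
      decide
    rw [h2] at ih
    rw [← not_iff_not, ← ih]
    omega
  have hall := h.induction (fun x => (c x = 1 ∨ c x = 2) ∧ (c v = c x ↔ col v = col x))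
    ⟨hv, by simp⟩ fun x hx ih => ⟨hK x hx, step x (p x) (h.adj x hx) (hK x hx) ih.1 ih.2⟩
  exact step w y hyw.symm hw (hK y hy) (hall y hy).2

end IsRootedTree

lemma parityLink_empty {col : V → Bool} (hcol : ∀ x y, G.Adj x y → col x ≠ col y) {u w : V}
    (h : G.Adj u w) : G.ParityLink col ∅ u w :=
  fun _ hc _ _ _ => iff_of_false (hc u w h) (hcol u w h)

end SimpleGraph

namespace SimpleGraph

variable {V : Type*} {G : SimpleGraph V}

/-- The subgraph of `G` induced on `K` is preconnected. -/
def ConnectedOn (G : SimpleGraph V) (K : Set V) : Prop :=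
  ∀ X ⊆ K, X.Nonempty → (∀ x ∈ X, ∀ y ∈ K, G.Adj x y → y ∈ X) → K ⊆ X

lemma ConnectedOn.exists_isRootedTree_diff {K : Set V} (hK : G.ConnectedOn K) {v : V}
    (hv : v ∈ K) : ∃ p d, G.IsRootedTree (K \ {v}) v p d := by
  classical
  let H : SimpleGraph V :=
    { Adj := fun x y => G.Adj x y ∧ x ∈ K ∧ y ∈ K
      symm := ⟨fun x y h => ⟨h.1.symm, h.2.2, h.2.1⟩⟩
      loopless := ⟨fun x h => h.1.ne rfl⟩ }
  have hreach : ∀ x ∈ K, H.Reachable x v := by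
    refine fun x hx => (hK {x | x ∈ K ∧ H.Reachable x v} (fun x hx => hx.1)
      ⟨v, hv, Reachable.refl v⟩ ?_ hx).2
    rintro x ⟨hx, hxv⟩ y hy hxy
    have hyx : H.Adj y x := ⟨hxy.symm, hy, hx⟩
    exact ⟨hy, hyx.reachable.trans hxv⟩
  have key : ∀ x, x ∈ K \ {v} → ∃ y, H.Adj x y ∧ H.dist y v < H.dist x v := by
    rintro x ⟨hx, hxv⟩
    obtain ⟨W, hW⟩ := (hreach x hx).exists_walk_length_eq_dist
    cases W with
    | nil => exact absurd rfl hxv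
    | cons h W' =>
      refine ⟨_, h, ?_⟩
      rw [← hW, Walk.length_cons]
      exact Nat.lt_succ_of_le (dist_le W')
  choose! p hp using key
  refine ⟨p, fun x => H.dist x v, fun h => h.2 rfl, fun x hx => ?_, fun x hx => (hp x hx).1.1,
    fun x hx => (hp x hx).2⟩
  by_cases h : p x = v
  · exact .inl h
  · exact .inr ⟨(hp x hx).1.2.2, h⟩

lemma ConnectedOn.exists_isRootedTree {K : Set V} (hK : G.ConnectedOn K) {v k : V}
    (hv : v ∉ K) (hk : k ∈ K) (hvk : G.Adj v k) :
    ∃ p d, G.IsRootedTree K v p d ∧ p k = v ∧ ∀ x ∈ K, p x = v → x = k := by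
  classical
  obtain ⟨p, d, h⟩ := hK.exists_isRootedTree_diff hk
  have hpK : ∀ x ∈ K, x ≠ k → p x ∈ K := fun x hx hxk => by
    rcases h.parent_mem x ⟨hx, hxk⟩ with h' | h'
    · rwa [h']
    · exact h'.1
  refine ⟨fun x => if x = k then v else p x, fun x => if x = v then 0 else d x + 1,
    ⟨hv, fun x hx => ?_, fun x hx => ?_, fun x hx => ?_⟩, if_pos rfl, fun x hx hpx => ?_⟩
  · by_cases hxk : x = k
    · simp [hxk]
    · simp [hxk, hpK x hx hxk]
  · by_cases hxk : x = k
    · simpa [hxk] using hvk.symm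
    · simpa [hxk] using h.adj x ⟨hx, hxk⟩
  · have hxv : x ≠ v := fun e => hv (e ▸ hx)
    by_cases hxk : x = k
    · simp [hxk] at hxv ⊢
      simp [hxv]
    · have hpv : p x ≠ v := fun e => hv (e ▸ hpK x hx hxk)
      simpa [hxk, hpv, hxv] using h.lt x ⟨hx, hxk⟩
  · by_contra hxk
    simp only [hxk, if_false] at hpx
    exact hv (hpx ▸ hpK x hx hxk)

lemma IsRootedTree.dead_of_forall_exists_adj [Finite V] {K : Set V} {v : V} {p : V → V}
    {d : V → ℕ} (h : G.IsRootedTree K v p d) (hne : K.Nonempty)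
    (hcl : ∀ x ∈ K, ∀ y, G.Adj x y → y = v ∨ y ∈ K) (hdeg : ∀ x z, ∃ y, G.Adj x y ∧ y ≠ z) :
    G.Dead K v := by
  obtain ⟨x, hx, hmax⟩ := Set.exists_max_image K d K.toFinite hne
  obtain ⟨y, hxy, hy⟩ := hdeg x (p x)
  refine h.dead hxy.symm hx (hcl x hx y hxy) hy.symm fun hyK e => ?_
  have := h.lt y hyK
  have := hmax y hyK
  rw [e] at *
  omega

lemma Choosable.connectedOn_compl_singleton [Finite V] (h : G.Choosable 2 1)
    (hconn : G.ConnectedOn Set.univ) (hdeg : ∀ x z, ∃ y, G.Adj x y ∧ y ≠ z) (v : V) :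
    G.ConnectedOn {v}ᶜ := by
  have hdead : ∀ K : Set V, v ∉ K → K.Nonempty →
      (∀ x ∈ K, ∀ y, G.Adj x y → y = v ∨ y ∈ K) → G.Dead K v := by
    intro K hvK hne hcl
    have hK : G.ConnectedOn (insert v K) := by
      intro X hX hXne hXcl y hy
      by_cases hvX : v ∈ X
      · by_contra hyX
        have := hconn (insert v K \ X) (Set.subset_univ _) ⟨y, hy, hyX⟩ (by
          rintro x ⟨hx, hxX⟩ z - hxz
          have hxK : x ∈ K := by
            rcases hx with rfl | hx
            · exact absurd hvX hxX
            · exact hx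
          exact ⟨hcl x hxK z hxz, fun hz => hxX (hXcl z hz x hx hxz.symm)⟩) (Set.mem_univ v)
        exact this.2 hvX
      · refine absurd (hconn X (Set.subset_univ _) hXne (fun x hx z _ hxz => ?_)
          (Set.mem_univ v)) hvX
        have hxK : x ∈ K := by
          rcases hX hx with rfl | h
          · exact absurd hx hvX
          · exact h
        exact hXcl x hx z (hcl x hxK z hxz) hxz
    obtain ⟨p, d, hT⟩ := hK.exists_isRootedTree_diff (Set.mem_insert v K)
    rw [Set.insert_sdiff_of_mem _ (Set.mem_singleton v), Set.sdiff_singleton_eq_self hvK] at hT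
    exact hT.dead_of_forall_exists_adj hne hcl hdeg
  intro X hX hne hcl y hy
  by_contra hyX
  refine h.false_of_dead (hdead X (fun hv => hX hv rfl) hne ?_)
    (hdead ({v}ᶜ \ X) (fun hv => hv.1 rfl) ⟨y, hy, hyX⟩ ?_) (fun hv => hX hv rfl)
    (fun hv => hv.1 rfl) Set.disjoint_sdiff_right
  · intro x hx z hxz
    by_cases hz : z = v
    · exact .inl hz
    · exact .inr (hcl x hx z hz hxz)
  · rintro x ⟨hx, hxX⟩ z hxz
    by_cases hz : z = v
    · exact .inl hz
    · exact .inr ⟨hz, fun hzX => hxX (hcl z hzX x hx hxz.symm)⟩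

end SimpleGraph

namespace SimpleGraph

variable {V : Type*} {G : SimpleGraph V}

/-- `y` is reached from `x` by following the parent function `p`, stopping at the root `v`. -/
def Ancestor (p : V → V) (v : V) : V → V → Prop :=
  Relation.ReflTransGen fun x y => x ≠ v ∧ p x = y

namespace IsRootedTree

variable {K : Set V} {v : V} {p : V → V} {d : V → ℕ}

lemma ne_root (h : G.IsRootedTree K v p d) {x : V} (hx : x ∈ K) : x ≠ v :=
  fun e => h.notMem (e ▸ hx)

lemma ancestor_rank (h : G.IsRootedTree K v p d) {x y : V} (hxy : Ancestor p v x y)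
    (hx : x = v ∨ x ∈ K) : (y = v ∨ y ∈ K) ∧ (y = x ∨ d y < d x) := by
  induction hxy with
  | refl => exact ⟨hx, .inl rfl⟩
  | tail _ hbc ih =>
    obtain ⟨hbv, rfl⟩ := hbc
    have hb := ih.1.resolve_left hbv
    refine ⟨h.parent_mem _ hb, .inr ?_⟩
    have := h.lt _ hb
    rcases ih.2 with h' | h'
    · rwa [← h']
    · omega

lemma ancestor_of_forall_child (h : G.IsRootedTree K v p d) {k : V}
    (hk : ∀ x ∈ K, p x = v → x = k) : ∀ x ∈ K, Ancestor p v x k := by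
  intro x hx
  refine h.induction (fun x => x ∈ K → Ancestor p v x k) (fun hv => absurd hv h.notMem)
    (fun x hx ih _ => ?_) x hx hx
  rcases h.parent_mem x hx with h' | h'
  · rw [hk x hx h']
    exact Relation.ReflTransGen.refl
  · exact Relation.ReflTransGen.head ⟨h.ne_root hx, rfl⟩ (ih h')

end IsRootedTree

lemma choosable_four_two_of_degree_le_two {a : V} (hconn : G.ConnectedOn {a}ᶜ)
    (hdeg : ∀ x z, ∃ y, G.Adj x y ∧ y ≠ z)
    (hdeg₂ : ∀ x y₁ y₂ y₃, G.Adj x y₁ → G.Adj x y₂ → G.Adj x y₃ → y₁ = y₂ ∨ y₁ = y₃ ∨ y₂ = y₃)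
    {col : V → Bool} (hcol : ∀ x y, G.Adj x y → col x ≠ col y) : G.Choosable 4 2 := by
  obtain ⟨u, hau, -⟩ := hdeg a a
  obtain ⟨w, haw, hwu⟩ := hdeg a u
  have hua : u ∈ ({a}ᶜ : Set V) := hau.ne'
  obtain ⟨p, d, hT⟩ := hconn.exists_isRootedTree_diff hua
  have hwK : w ∈ ({a}ᶜ : Set V) \ {u} := ⟨haw.ne', hwu⟩
  have hnea : ∀ x, x = u ∨ x ∈ ({a}ᶜ : Set V) \ {u} → x ≠ a := by
    rintro x (rfl | hx)
    · exact hau.ne'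
    · exact hx.1
  have key : ∀ z, Ancestor p u w z → ∀ y, y ≠ a → G.Adj z y →
      (z ≠ u ∧ p z = y) ∨ (y ≠ u ∧ p y = z ∧ Ancestor p u w y) := by
    intro z hz y hya hzy
    have hzK := (hT.ancestor_rank hz (.inr hwK)).1
    rcases hz.cases_tail with rfl | ⟨z', hwz', hz'u, rfl⟩
    · left
      have hpa := hnea _ (hT.parent_mem z hwK)
      have := hdeg₂ z y (p z) a hzy (hT.adj z hwK) haw.symm
      exact ⟨hwu, by tauto⟩
    · have hz'K := (hT.ancestor_rank hwz' (.inr hwK)).1.resolve_left hz'u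
      have hadj := hT.adj z' hz'K
      by_cases hpu : p z' = u
      · right
        have := hdeg₂ (p z') y z' a hzy hadj.symm (hpu ▸ hau.symm)
        have hz'a := hnea z' (.inr hz'K)
        obtain rfl : y = z' := by tauto
        exact ⟨hz'u, rfl, hwz'⟩
      · have hK := hzK.resolve_left hpu
        have := hdeg₂ (p z') y z' (p (p z')) hzy hadj.symm (hT.adj _ hK)
        have hne : z' ≠ p (p z') := by
          intro e
          have h1 := hT.lt _ hz'K
          have h2 := hT.lt _ hK
          rw [← e] at h2
          omega
        rcases this with h | h | h
        · subst h
          exact .inr ⟨hz'u, rfl, hwz'⟩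
        · exact .inl ⟨hpu, h.symm⟩
        · exact absurd h hne
  have hall : ({a}ᶜ : Set V) ⊆ {z | Ancestor p u w z} := by
    refine hconn _ (fun z hz => hnea z (hT.ancestor_rank hz (.inr hwK)).1)
      ⟨w, Relation.ReflTransGen.refl⟩ fun x hx y hy hxy => ?_
    rcases key x hx y hy hxy with ⟨h1, h2⟩ | h
    · exact Relation.ReflTransGen.tail hx ⟨h1, h2⟩
    · exact h.2.2
  have hN : ∀ x, G.Adj a x → x = u ∨ x = w := by
    intro x hx
    have := hdeg₂ a x u w hx hau haw
    rcases this with h | h | h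
    · exact .inl h
    · exact .inr h
    · exact absurd h.symm hwu
  refine choosable_four_two_of_parent G u w a a hau.ne' hau.ne' haw.ne' haw.ne' hN hN p d ?_ ?_
    col hcol ?_
  · intro x hxa _ hxu
    have hxK : x ∈ ({a}ᶜ : Set V) \ {u} := ⟨hxa, hxu⟩
    have hpa := hnea _ (hT.parent_mem x hxK)
    exact ⟨hpa, hpa, hT.adj x hxK, hT.lt x hxK⟩
  · intro x y hxy hxa _ hya _
    rcases key x (hall hxa) y hya hxy with h | h
    · exact .inl h
    · exact .inr ⟨h.1, h.2.1⟩
  · have h1 := hcol a u hau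
    have h2 := hcol a w haw
    revert h1 h2
    generalize col a = i
    generalize col u = j
    generalize col w = k
    revert i j k
    decide

lemma Choosable.exists_four_cycle [Finite V] (h : G.Choosable 2 1) {u : V}
    (hconn : G.ConnectedOn {u}ᶜ) {col : V → Bool} (hcol : ∀ x y, G.Adj x y → col x ≠ col y)
    {k q r : V} (huk : G.Adj u k) (huq : G.Adj u q) (hur : G.Adj u r) (hkq : k ≠ q) (hkr : k ≠ r)
    (hqr : q ≠ r) : ∃ w a b, w ≠ u ∧ a ≠ b ∧ G.Adj u a ∧ G.Adj u b ∧ G.Adj w a ∧ G.Adj w b := by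
  have htri : ∀ x y z, G.Adj x y → G.Adj y z → ¬ G.Adj x z := by
    intro x y z h1 h2 h3
    have h1 := hcol _ _ h1
    have h2 := hcol _ _ h2
    have h3 := hcol _ _ h3
    revert h1 h2 h3
    generalize col x = i
    generalize col y = j
    generalize col z = k
    revert i j k
    decide
  obtain ⟨p, d, hT, hpk, hk⟩ := hconn.exists_isRootedTree (fun h => h rfl)
    (show k ∈ ({u}ᶜ : Set V) from huk.ne') huk
  have hmem : ∀ x, x = u ∨ x ∈ ({u}ᶜ : Set V) := fun x => em (x = u)
  have hanck : ∀ x, x ≠ u → Ancestor p u x k := fun x hx => hT.ancestor_of_forall_child hk x hx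
  have hrank : ∀ {x y}, Ancestor p u x y → x ≠ y → d y < d x := fun {x y} hxy hne =>
    (hT.ancestor_rank hxy (hmem x)).2.resolve_left hne.symm
  obtain ⟨w, ⟨hqw, hrw⟩, hmax⟩ := Set.exists_max_image {w | Ancestor p u q w ∧ Ancestor p u r w} d
    (Set.toFinite _) ⟨k, hanck q huq.ne', hanck r hur.ne'⟩
  have hwu : w ≠ u := by
    rintro rfl
    have h1 := hmax k ⟨hanck q huq.ne', hanck r hur.ne'⟩
    have h2 := hT.lt k huk.ne'
    rw [hpk] at h2
    omega
  have hsegT : ∀ x, Ancestor p u x w →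
      G.IsRootedTree {z | Ancestor p u x z ∧ Ancestor p u z w ∧ z ≠ w} w p d := by
    intro x hx
    have hz : ∀ z, Ancestor p u z w → z ≠ w → z ≠ u ∧ Ancestor p u (p z) w := by
      intro z hz hne
      rcases hz.cases_head with h | ⟨_, ⟨hzu, rfl⟩, h⟩
      · exact absurd h hne
      · exact ⟨hzu, h⟩
    refine ⟨fun h => h.2.2 rfl, ?_, ?_, ?_⟩
    · rintro z ⟨h1, h2, h3⟩
      by_cases hpz : p z = w
      · exact .inl hpz
      · exact .inr ⟨h1.tail ⟨(hz z h2 h3).1, rfl⟩, (hz z h2 h3).2, hpz⟩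
    · rintro z ⟨h1, h2, h3⟩
      exact hT.adj z (hz z h2 h3).1
    · rintro z ⟨h1, h2, h3⟩
      exact hT.lt z (hz z h2 h3).1
  have htopT : G.IsRootedTree {z | Ancestor p u w z ∧ z ≠ w ∧ z ≠ u} u p d := by
    refine ⟨fun h => h.2.2 rfl, ?_, fun z hz => hT.adj z hz.2.2, fun z hz => hT.lt z hz.2.2⟩
    rintro z ⟨h1, h2, h3⟩
    by_cases hpz : p z = u
    · exact .inl hpz
    · refine .inr ⟨h1.tail ⟨h3, rfl⟩, fun e => ?_, hpz⟩
      have := hrank h1 h2.symm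
      have := hT.lt z h3
      rw [e] at this
      omega
  have hQT := hsegT q hqw
  have hRT := hsegT r hrw
  set Q : Set V := {z | Ancestor p u q z ∧ Ancestor p u z w ∧ z ≠ w} with hQ
  set R : Set V := {z | Ancestor p u r z ∧ Ancestor p u z w ∧ z ≠ w} with hR
  set P : Set V := {z | Ancestor p u w z ∧ z ≠ w ∧ z ≠ u} with hP
  have huseg : ¬ Ancestor p u u w := by
    intro h
    rcases h.cases_head with h | ⟨_, ⟨hzu, -⟩, -⟩
    · exact hwu h.symm
    · exact hzu rfl
  have huQ : u ∉ Q := fun h => huseg h.2.1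
  have huR : u ∉ R := fun h => huseg h.2.1
  have huP : u ∉ P := htopT.notMem
  have hwQ : w ∉ Q := hQT.notMem
  have hwR : w ∉ R := hRT.notMem
  have hwP : w ∉ P := fun h => h.2.1 rfl
  have hdQR : Disjoint Q R := by
    rw [Set.disjoint_left]
    rintro z ⟨h1, h2, h3⟩ ⟨h4, -, -⟩
    have := hmax z ⟨h1, h4⟩
    have := hrank h2 h3
    omega
  have hdQP : Disjoint Q P := by
    rw [Set.disjoint_left]
    rintro z ⟨h1, h2, h3⟩ ⟨h4, -, -⟩
    have := hrank h4 h3.symm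
    have := hrank h2 h3
    omega
  have hdRP : Disjoint R P := by
    rw [Set.disjoint_left]
    rintro z ⟨h1, h2, h3⟩ ⟨h4, -, -⟩
    have := hrank h4 h3.symm
    have := hrank h2 h3
    omega
  have hqQ : q ≠ w → q ∈ Q := fun hne => ⟨.refl, hqw, hne⟩
  have hrR : r ≠ w → r ∈ R := fun hne => ⟨.refl, hrw, hne⟩
  have hpw : G.Adj w (p w) := hT.adj w hwu
  have hpP : w ≠ k → p w ∈ P := fun hne =>
    ⟨.single ⟨hwu, rfl⟩, hpw.ne', fun e => hne (hk w hwu e)⟩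
  have hppk : ∀ _ : w ≠ k, p (p w) = u → p w = k := fun hne e => hk _ (hpP hne).2.2 e
  have hQs : q ≠ w → p q ≠ w → G.StrongLink Q u w := fun h1 h2 =>
    (hQT.strongLink huq.symm (hqQ h1) h2).symm
  have hRs : r ≠ w → p r ≠ w → G.StrongLink R u w := fun h1 h2 =>
    (hRT.strongLink hur.symm (hrR h1) h2).symm
  have hPs : w ≠ k → p w ≠ k → G.StrongLink P u w := fun h1 h2 =>
    htopT.strongLink hpw.symm (hpP h1) (mt (hppk h1) h2)
  have hpq : p q = w → q ≠ w → G.Adj q w := fun e _ => e ▸ hT.adj q huq.ne'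
  have hpr : p r = w → r ≠ w → G.Adj r w := fun e _ => e ▸ hT.adj r hur.ne'
  have hpk' : p w = k → G.Adj w k := fun e => e ▸ hpw
  by_cases huw : G.Adj u w
  · exfalso
    have hE := parityLink_empty hcol huw
    have hq' : q ≠ w → p q ≠ w := fun h1 e => htri u q w huq (hpq e h1) huw
    have hr' : r ≠ w → p r ≠ w := fun h1 e => htri u r w hur (hpr e h1) huw
    have hk' : p w ≠ k := fun e => htri u w k huw (hpk' e) huk
    by_cases hq : q = w
    · have h1 : r ≠ w := fun e => hqr (hq.trans e.symm)
      have h2 : w ≠ k := fun e => hkq (e.symm.trans hq.symm)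
      exact h.false_of_strongLink hE (hRs h1 (hr' h1)) (hPs h2 hk')
        ⟨id, huR, huP⟩ ⟨id, hwR, hwP⟩ (Set.empty_disjoint _) (Set.empty_disjoint _) hdRP
    · by_cases hk0 : w = k
      · have h1 : r ≠ w := fun e => hkr (hk0.symm.trans e.symm)
        exact h.false_of_strongLink hE (hQs hq (hq' hq)) (hRs h1 (hr' h1))
          ⟨id, huQ, huR⟩ ⟨id, hwQ, hwR⟩ (Set.empty_disjoint _) (Set.empty_disjoint _) hdQR
      · exact h.false_of_strongLink hE (hQs hq (hq' hq)) (hPs hk0 hk')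
          ⟨id, huQ, huP⟩ ⟨id, hwQ, hwP⟩ (Set.empty_disjoint _) (Set.empty_disjoint _) hdQP
  · have hqw' : q ≠ w := fun e => huw (e ▸ huq)
    have hrw' : r ≠ w := fun e => huw (e ▸ hur)
    have hkw' : w ≠ k := fun e => huw (e ▸ huk)
    by_cases h1 : p q = w
    · by_cases h2 : p r = w
      · exact ⟨w, q, r, hwu, hqr, huq, hur, (hpq h1 hqw').symm, (hpr h2 hrw').symm⟩
      · by_cases h3 : p w = k
        · exact ⟨w, q, k, hwu, hkq.symm, huq, huk, (hpq h1 hqw').symm, hpk' h3⟩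
        · exact (h.false_of_strongLink (hQT.parityLink hcol huq.symm (hqQ hqw')).symm
            (hRs hrw' h2) (hPs hkw' h3) ⟨huQ, huR, huP⟩ ⟨hwQ, hwR, hwP⟩ hdQR hdQP hdRP).elim
    · by_cases h2 : p r = w
      · by_cases h3 : p w = k
        · exact ⟨w, r, k, hwu, hkr.symm, hur, huk, (hpr h2 hrw').symm, hpk' h3⟩
        · exact (h.false_of_strongLink (hRT.parityLink hcol hur.symm (hrR hrw')).symm
            (hQs hqw' h1) (hPs hkw' h3) ⟨huR, huQ, huP⟩ ⟨hwR, hwQ, hwP⟩ hdQR.symm hdRP hdQP).elim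
      · exact (h.false_of_strongLink (htopT.parityLink hcol hpw.symm (hpP hkw'))
            (hQs hqw' h1) (hRs hrw' h2) ⟨huP, huQ, huR⟩ ⟨hwP, hwQ, hwR⟩ hdQP.symm hdRP.symm
            hdQR).elim

end SimpleGraph

namespace SimpleGraph

variable {V : Type*} {G : SimpleGraph V}

/-- `u, a, w, b` are the consecutive vertices of a four-cycle of `G`. -/
structure IsFourCycle (G : SimpleGraph V) (u a w b : V) : Prop where
  adj₁ : G.Adj u a
  adj₂ : G.Adj a w
  adj₃ : G.Adj w b
  adj₄ : G.Adj b u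
  ne₁ : u ≠ w
  ne₂ : a ≠ b

/-- `K` is a connected component of what remains of `G` after removing `u, a, w, b`. -/
structure IsCycleComponent (G : SimpleGraph V) (u a w b : V) (K : Set V) : Prop where
  notMem₁ : u ∉ K
  notMem₂ : a ∉ K
  notMem₃ : w ∉ K
  notMem₄ : b ∉ K
  conn : G.ConnectedOn K
  closed : ∀ x ∈ K, ∀ y, G.Adj x y → y = u ∨ y = a ∨ y = w ∨ y = b ∨ y ∈ K

lemma IsFourCycle.rotate {u a w b : V} (h : G.IsFourCycle u a w b) : G.IsFourCycle a w b u :=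
  ⟨h.adj₂, h.adj₃, h.adj₄, h.adj₁, h.ne₂, h.ne₁.symm⟩

lemma IsFourCycle.reflect {u a w b : V} (h : G.IsFourCycle u a w b) : G.IsFourCycle u b w a :=
  ⟨h.adj₄.symm, h.adj₃.symm, h.adj₂.symm, h.adj₁.symm, h.ne₁, h.ne₂.symm⟩

lemma IsCycleComponent.rotate {u a w b : V} {K : Set V} (h : G.IsCycleComponent u a w b K) :
    G.IsCycleComponent a w b u K :=
  ⟨h.notMem₂, h.notMem₃, h.notMem₄, h.notMem₁, h.conn, fun x hx y hxy => by
    have := h.closed x hx y hxy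
    tauto⟩

lemma IsCycleComponent.reflect {u a w b : V} {K : Set V} (h : G.IsCycleComponent u a w b K) :
    G.IsCycleComponent u b w a K :=
  ⟨h.notMem₁, h.notMem₄, h.notMem₃, h.notMem₂, h.conn, fun x hx y hxy => by
    have := h.closed x hx y hxy
    tauto⟩

lemma IsFourCycle.dead [Finite V] {u a w b : V} (h : G.IsFourCycle u a w b) :
    G.Dead {a, w, b} u := by
  classical
  have h1 := h.adj₁.ne
  have h2 := h.adj₂.ne
  have h3 := h.adj₃.ne
  have h4 := h.adj₄.ne
  have h5 := h.ne₁
  have h6 := h.ne₂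
  have hT : G.IsRootedTree {a, w, b} u (fun x => if x = w then a else u)
      (fun x => if x = u then 0 else if x = w then 2 else 1) := by
    refine ⟨by simp [h1, h4.symm, h5], ?_, ?_, ?_⟩
    · rintro x (rfl | rfl | rfl) <;> simp [h2, h3.symm]
    · rintro x (rfl | rfl | rfl)
      · simpa [h2] using h.adj₁.symm
      · simpa using h.adj₂.symm
      · simpa [h3.symm] using h.adj₄
    · rintro x (rfl | rfl | rfl)
      · simp [h1.symm, h2]
      · simp [h1.symm, h2, h5.symm]
      · simp [h4, h3.symm]
  refine hT.dead h.adj₃.symm (by simp) (by simp) ?_ ?_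
  · simpa using h6
  · intro _
    simpa [h3.symm] using h5

namespace IsCycleComponent

variable {u a w b k : V} {K : Set V}

lemma exists_isRootedTree [Finite V] (h : G.IsCycleComponent u a w b K) (hG : G.Choosable 2 1)
    (hC : G.IsFourCycle u a w b) (hk : k ∈ K) (huk : G.Adj u k) :
    ∃ p d, G.IsRootedTree K u p d ∧ (∀ x ∈ K, G.Adj u x → x = k) ∧
      ∀ x ∈ K, ∀ y, (y = u ∨ y ∈ K) → G.Adj x y → p x = y ∨ (y ∈ K ∧ p y = x) := by
  obtain ⟨p, d, hT, hpk, hk'⟩ := h.conn.exists_isRootedTree h.notMem₁ hk huk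
  have hpar : ∀ x ∈ K, ∀ y, (y = u ∨ y ∈ K) → G.Adj x y → p x = y ∨ (y ∈ K ∧ p y = x) := by
    intro x hx y hy hxy
    by_contra! hcon
    refine hG.false_of_dead (hT.dead hxy.symm hx hy hcon.1 hcon.2) hC.dead hT.notMem ?_ ?_
    · simp [hC.adj₁.ne, hC.adj₄.ne', hC.ne₁]
    · rw [Set.disjoint_left]
      rintro z hz (rfl | rfl | rfl)
      · exact h.notMem₂ hz
      · exact h.notMem₃ hz
      · exact h.notMem₄ hz
  refine ⟨p, d, hT, fun x hx hux => hk' x hx ?_, hpar⟩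
  rcases hpar x hx u (.inl rfl) hux.symm with h' | h'
  · exact h'
  · exact absurd h'.1 h.notMem₁

lemma not_adj [Finite V] (h : G.IsCycleComponent u a w b K) (hG : G.Choosable 2 1)
    {col : V → Bool} (hcol : ∀ x y, G.Adj x y → col x ≠ col y)
    (hC : G.IsFourCycle u a w b) (hk : k ∈ K) (huk : G.Adj u k) :
    ∀ y ∈ K, ¬ G.Adj a y := by
  classical
  intro y hy hay
  obtain ⟨p, d, hT, -, -⟩ := h.exists_isRootedTree hG hC hk huk
  have h1 := hC.adj₁.ne
  have h3 := hC.adj₃.ne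
  have h4 := hC.adj₄.ne
  have h5 := hC.ne₁
  have hT' : G.IsRootedTree {w, b} u (fun x => if x = w then b else u)
      (fun x => if x = u then 0 else if x = w then 2 else 1) := by
    refine ⟨by simp [h4.symm, h5], ?_, ?_, ?_⟩
    · rintro x (rfl | rfl) <;> simp [h3.symm]
    · rintro x (rfl | rfl)
      · simpa using hC.adj₃
      · simpa [h3.symm] using hC.adj₄
    · rintro x (rfl | rfl)
      · simp [h4, h3.symm, h5.symm]
      · simp [h4, h3.symm]
  have hpy : p y ≠ u := by
    intro e
    have e1 := hcol _ _ (e ▸ hT.adj y hy)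
    have e2 := hcol _ _ hay
    have e3 := hcol _ _ hC.adj₁
    revert e1 e2 e3
    generalize col u = i
    generalize col a = j
    generalize col y = k
    revert i j k
    decide
  refine hG.false_of_strongLink (parityLink_empty hcol hC.adj₁) (hT.strongLink hay.symm hy hpy)
    (hT'.strongLink hC.adj₂.symm (by simp) (by simpa using h4)) ⟨id, h.notMem₁, hT'.notMem⟩
    ⟨id, h.notMem₂, by simp [hC.adj₂.ne, hC.ne₂]⟩ (Set.empty_disjoint _) (Set.empty_disjoint _) ?_
  rw [Set.disjoint_left]
  rintro z hz (rfl | rfl)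
  · exact h.notMem₃ hz
  · exact h.notMem₄ hz

lemma exists_adj_opposite [Finite V] (h : G.IsCycleComponent u a w b K) (hG : G.Choosable 2 1)
    {col : V → Bool} (hcol : ∀ x y, G.Adj x y → col x ≠ col y)
    (hconn : ∀ v, G.ConnectedOn {v}ᶜ)
    (hC : G.IsFourCycle u a w b) (hk : k ∈ K) (huk : G.Adj u k) :
    ∃ y ∈ K, G.Adj w y := by
  by_contra! hcon
  refine h.notMem₂ (hconn u K (fun x hx e => h.notMem₁ (e ▸ hx)) ⟨k, hk⟩ ?_ hC.adj₁.ne')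
  intro x hx y hyu hxy
  have ha := h.not_adj hG hcol hC hk huk x hx
  have hb := h.reflect.not_adj hG hcol hC.reflect hk huk x hx
  have hw := hcon x hx
  rcases h.closed x hx y hxy with rfl | rfl | rfl | rfl | h'
  · exact absurd rfl hyu
  · exact absurd hxy.symm ha
  · exact absurd hxy.symm hw
  · exact absurd hxy.symm hb
  · exact h'

/-- Two different components cannot be attached to the same pair of opposite vertices. -/
lemma disjoint_false_of_same [Finite V] {k' : V} {K' : Set V} (h : G.IsCycleComponent u a w b K)
    (h' : G.IsCycleComponent u a w b K') (hd : Disjoint K K') (hG : G.Choosable 2 1)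
    {col : V → Bool} (hcol : ∀ x y, G.Adj x y → col x ≠ col y)
    (hconn : ∀ v, G.ConnectedOn {v}ᶜ) (hC : G.IsFourCycle u a w b) (hk : k ∈ K)
    (huk : G.Adj u k) (hk' : k' ∈ K') (huk' : G.Adj u k') : False := by
  classical
  obtain ⟨p, d, hT, -, -⟩ := h.exists_isRootedTree hG hC hk huk
  obtain ⟨p', d', hT', -, -⟩ := h'.exists_isRootedTree hG hC hk' huk'
  obtain ⟨y, hy, hwy⟩ := h.exists_adj_opposite hG hcol hconn hC hk huk
  obtain ⟨y', hy', hwy'⟩ := h'.exists_adj_opposite hG hcol hconn hC hk' huk'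
  have hsingle : ∀ z, G.Adj u z → G.Adj z w → G.WeakLink {z} u w := by
    intro z huz hzw
    have : G.IsRootedTree {z} u (fun _ => u) (fun x => if x = z then 1 else 0) := by
      refine ⟨huz.ne, fun _ _ => .inl rfl, ?_, ?_⟩
      · rintro x rfl
        exact huz.symm
      · rintro x rfl
        simp [huz.ne]
    exact this.weakLink hzw rfl
  have e1 := h.notMem₂
  have e2 := h.notMem₄
  have e3 := h'.notMem₂
  have e4 := h'.notMem₄
  have e5 := hC.ne₂
  rw [Set.disjoint_left] at hd
  refine hG.false_of_weakLink ![K, K', {a}, {b}] hC.ne₁ ?_ ?_ ?_ ?_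
  · intro i
    fin_cases i
    · exact hT.weakLink hwy.symm hy
    · exact hT'.weakLink hwy'.symm hy'
    · exact hsingle a hC.adj₁ hC.adj₂
    · exact hsingle b hC.adj₄.symm hC.adj₃.symm
  · intro i
    fin_cases i
    · exact h.notMem₁
    · exact h'.notMem₁
    · exact hC.adj₁.ne
    · exact hC.adj₄.ne'
  · intro i
    fin_cases i
    · exact h.notMem₃
    · exact h'.notMem₃
    · exact hC.adj₂.ne'
    · exact hC.adj₃.ne
  · intro i j x
    fin_cases i <;> fin_cases j <;> simp <;> grind

/-- Two different components cannot be attached to different pairs of opposite vertices. -/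
lemma disjoint_false_of_ne [Finite V] {k' : V} {K' : Set V} (h : G.IsCycleComponent u a w b K)
    (h' : G.IsCycleComponent u a w b K') (hd : Disjoint K K') (hG : G.Choosable 2 1)
    {col : V → Bool} (hcol : ∀ x y, G.Adj x y → col x ≠ col y)
    (hconn : ∀ v, G.ConnectedOn {v}ᶜ) (hC : G.IsFourCycle u a w b) (hk : k ∈ K)
    (huk : G.Adj u k) (hk' : k' ∈ K') (hak' : G.Adj a k') : False := by
  classical
  have key : ∀ {u a w b k : V} {K : Set V}, G.IsCycleComponent u a w b K → G.IsFourCycle u a w b →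
      k ∈ K → G.Adj u k → G.StrongLink (insert w K) u a := by
    intro u a w b k K h hC hk huk
    obtain ⟨p, d, hT, -, -⟩ := h.exists_isRootedTree hG hC hk huk
    obtain ⟨y, hy, hwy⟩ := h.exists_adj_opposite hG hcol hconn hC hk huk
    have hne : ∀ x ∈ K, x ≠ w := fun x hx e => h.notMem₃ (e ▸ hx)
    have hT' : G.IsRootedTree (insert w K) u (fun x => if x = w then y else p x)
        (fun x => if x = w then d y + 1 else d x) := by
      refine ⟨?_, ?_, ?_, ?_⟩
      · rintro (h' | h')
        · exact hC.ne₁ h'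
        · exact h.notMem₁ h'
      · rintro x (rfl | hx)
        · simp [hy]
        · simp only [hne x hx, if_false, Set.mem_insert_iff]
          rcases hT.parent_mem x hx with h' | h'
          · exact .inl h'
          · exact .inr (.inr h')
      · rintro x (rfl | hx)
        · simpa using hwy
        · simpa [hne x hx] using hT.adj x hx
      · rintro x (rfl | hx)
        · simp [hne y hy]
        · have hpw : p x ≠ w := by
            rcases hT.parent_mem x hx with h' | h'
            · rw [h']
              exact hC.ne₁
            · exact hne _ h'
          simpa [hne x hx, hpw] using hT.lt x hx
    refine hT'.strongLink hC.adj₂.symm (by simp) ?_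
    simp only [if_true]
    exact fun e => h.notMem₁ (e ▸ hy)
  have s1 := key h hC hk huk
  have s2 := (key h'.rotate.reflect hC.rotate.reflect hk' hak').symm
  rw [Set.disjoint_left] at hd
  refine hG.false_of_strongLink (parityLink_empty hcol hC.adj₁) s1 s2 ⟨id, ?_, ?_⟩ ⟨id, ?_, ?_⟩
    (Set.empty_disjoint _) (Set.empty_disjoint _) ?_
  · rintro (e | e)
    · exact hC.ne₁ e
    · exact h.notMem₁ e
  · rintro (e | e)
    · exact hC.adj₄.ne' e
    · exact h'.notMem₁ e
  · rintro (e | e)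
    · exact hC.adj₂.ne e
    · exact h.notMem₂ e
  · rintro (e | e)
    · exact hC.ne₂ e
    · exact h'.notMem₂ e
  · rw [Set.disjoint_left]
    rintro z (rfl | hz) (hz' | hz')
    · exact hC.adj₃.ne hz'
    · exact h'.notMem₃ hz'
    · exact h.notMem₄ (hz' ▸ hz)
    · exact hd hz hz'

end IsCycleComponent

lemma exists_isCycleComponent (G : SimpleGraph V) {u a w b k : V} (hu : k ≠ u) (ha : k ≠ a)
    (hw : k ≠ w) (hb : k ≠ b) : ∃ K, k ∈ K ∧ G.IsCycleComponent u a w b K := by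
  let r : V → V → Prop := fun x y =>
    G.Adj x y ∧ (x ≠ u ∧ x ≠ a ∧ x ≠ w ∧ x ≠ b) ∧ y ≠ u ∧ y ≠ a ∧ y ≠ w ∧ y ≠ b
  have hr : ∀ x y, r x y → r y x := fun x y h => ⟨h.1.symm, h.2.2, h.2.1⟩
  have hne : ∀ x, Relation.ReflTransGen r k x → x ≠ u ∧ x ≠ a ∧ x ≠ w ∧ x ≠ b := by
    intro x hx
    rcases hx.cases_tail with rfl | ⟨y, -, hy⟩
    · exact ⟨hu, ha, hw, hb⟩
    · exact hy.2.2
  refine ⟨{x | Relation.ReflTransGen r k x}, .refl, fun h => (hne u h).1 rfl,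
    fun h => (hne a h).2.1 rfl, fun h => (hne w h).2.2.1 rfl, fun h => (hne b h).2.2.2 rfl, ?_, ?_⟩
  · rintro X hX ⟨x, hx⟩ hcl y hy
    have hsymm : Relation.ReflTransGen r x k := by
      have hkx : Relation.ReflTransGen r k x := hX hx
      clear hx
      induction hkx with
      | refl => exact .refl
      | tail _ h2 ih => exact ih.head (hr _ _ h2)
    have hxy := hsymm.trans hy
    clear hy
    induction hxy with
    | refl => exact hx
    | tail h1 h2 ih => exact hcl _ ih _ ((hX ih).tail h2) h2.1
  · intro x hx y hxy
    by_contra! hcon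
    exact hcon.2.2.2.2 (hx.tail ⟨hxy, hne x hx, hcon.1, hcon.2.1, hcon.2.2.1, hcon.2.2.2.1⟩)

lemma choosable_four_two_of_isFourCycle [Finite V] {u a w b k : V} (hG : G.Choosable 2 1)
    {col : V → Bool} (hcol : ∀ x y, G.Adj x y → col x ≠ col y)
    (hconn : ∀ v, G.ConnectedOn {v}ᶜ) (hC : G.IsFourCycle u a w b) (huk : G.Adj u k)
    (hka : k ≠ a) (hkb : k ≠ b) : G.Choosable 4 2 := by
  classical
  have hsame : ∀ {x y z : V}, G.Adj x y → G.Adj y z → col x = col z := by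
    intro x y z h1 h2
    have h1 := hcol _ _ h1
    have h2 := hcol _ _ h2
    revert h1 h2
    generalize col x = i
    generalize col y = j
    generalize col z = k
    revert i j k
    decide
  have huw : col u = col w := hsame hC.adj₁ hC.adj₂
  have hab : col a = col b := hsame hC.adj₂ hC.adj₃
  have hkw : k ≠ w := fun e => hcol u k huk (e ▸ huw)
  obtain ⟨K, hk, hK⟩ := G.exists_isCycleComponent huk.ne' hka hkw hkb
  have hall : ∀ x, x = u ∨ x = a ∨ x = w ∨ x = b ∨ x ∈ K := by
    by_contra! hcon
    obtain ⟨x, hxu, hxa, hxw, hxb, hxK⟩ := hcon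
    obtain ⟨K', hx, hK'⟩ := G.exists_isCycleComponent hxu hxa hxw hxb
    have hd : Disjoint K K' := by
      rw [Set.disjoint_left]
      intro z hz hz'
      apply hxK
      refine (hK'.conn (K ∩ K') Set.inter_subset_right ⟨z, hz, hz'⟩ ?_ hx).1
      rintro s ⟨hs, hs'⟩ t ht hst
      rcases hK.closed s hs t hst with rfl | rfl | rfl | rfl | h
      · exact absurd ht hK'.notMem₁
      · exact absurd ht hK'.notMem₂
      · exact absurd ht hK'.notMem₃
      · exact absurd ht hK'.notMem₄
      · exact ⟨h, ht⟩
    obtain ⟨y, hy, hwy⟩ := hK.exists_adj_opposite hG hcol hconn hC hk huk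
    refine hxK ?_
    have h1 : ∀ z ∈ K', ¬ G.Adj u z := fun z hz huz =>
      hK.disjoint_false_of_same hK' hd hG hcol hconn hC hk huk hz huz
    have h2 : ∀ z ∈ K', ¬ G.Adj a z := fun z hz haz =>
      hK.disjoint_false_of_ne hK' hd hG hcol hconn hC hk huk hz haz
    have h3 : ∀ z ∈ K', ¬ G.Adj w z := fun z hz hwz =>
      hK.rotate.rotate.disjoint_false_of_same hK'.rotate.rotate hd hG hcol hconn hC.rotate.rotate
        hy hwy hz hwz
    have h4 : ∀ z ∈ K', ¬ G.Adj b z := fun z hz hbz =>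
      hK.reflect.disjoint_false_of_ne hK'.reflect hd hG hcol hconn hC.reflect hk huk hz hbz
    refine absurd (hconn u K' (fun z hz e => hK'.notMem₁ (e ▸ hz)) ⟨x, hx⟩ ?_ hC.adj₁.ne')
      hK'.notMem₂
    intro s hs t _ hst
    rcases hK'.closed s hs t hst with rfl | rfl | rfl | rfl | h
    · exact absurd hst.symm (h1 s hs)
    · exact absurd hst.symm (h2 s hs)
    · exact absurd hst.symm (h3 s hs)
    · exact absurd hst.symm (h4 s hs)
    · exact h
  obtain ⟨p, d, hT, -, hpar⟩ := hK.exists_isRootedTree hG hC hk huk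
  obtain ⟨y, hy, hwy⟩ := hK.exists_adj_opposite hG hcol hconn hC hk huk
  obtain ⟨-, -, -, hwuniq, -⟩ := hK.rotate.rotate.exists_isRootedTree hG hC.rotate.rotate hy hwy
  have haK := hK.not_adj hG hcol hC hk huk
  have hbK := hK.reflect.not_adj hG hcol hC.reflect hk huk
  have hneK : ∀ {x}, x ∈ K → x ≠ u ∧ x ≠ a ∧ x ≠ w ∧ x ≠ b := fun {x} hx =>
    ⟨fun e => hK.notMem₁ (e ▸ hx), fun e => hK.notMem₂ (e ▸ hx), fun e => hK.notMem₃ (e ▸ hx),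
      fun e => hK.notMem₄ (e ▸ hx)⟩
  have hNa : ∀ x, G.Adj a x → x = u ∨ x = w := by
    intro x hax
    rcases hall x with h | rfl | h | rfl | h
    · exact .inl h
    · exact absurd rfl hax.ne
    · exact .inr h
    · exact absurd hab (hcol _ _ hax)
    · exact absurd hax (haK x h)
  have hNb : ∀ x, G.Adj b x → x = u ∨ x = w := by
    intro x hbx
    rcases hall x with h | rfl | h | rfl | h
    · exact .inl h
    · exact absurd hab.symm (hcol _ _ hbx)
    · exact .inr h
    · exact absurd rfl hbx.ne
    · exact absurd hbx (hbK x h)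
  have hpK : ∀ x ∈ K, p x ≠ a ∧ p x ≠ b ∧ p x ≠ w := by
    intro x hx
    rcases hT.parent_mem x hx with h | h
    · rw [h]
      exact ⟨hC.adj₁.ne, hC.adj₄.ne', hC.ne₁⟩
    · exact ⟨(hneK h).2.1, (hneK h).2.2.2, (hneK h).2.2.1⟩
  refine choosable_four_two_of_parent G u w a b hC.adj₁.ne hC.adj₄.ne' hC.adj₂.ne' hC.adj₃.ne
    hNa hNb (fun x => if x = w then y else p x) (fun x => if x = w then d y + 1 else d x) ?_ ?_
    col hcol huw
  · intro x hxa hxb hxu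
    by_cases hxw : x = w
    · subst hxw
      have := hneK hy
      simp [this, hwy]
    · have hx : x ∈ K := by
        have := hall x
        tauto
      have := hpK x hx
      simpa [hxw, this] using ⟨hT.adj x hx, hT.lt x hx⟩
  · have key : ∀ x z, G.Adj x z → x ∈ K → z ≠ a → z ≠ b →
        (x ≠ u ∧ (if x = w then y else p x) = z) ∨ (z ≠ u ∧ (if z = w then y else p z) = x) := by
      intro x z hxz hx hza hzb
      have hx' := hneK hx
      by_cases hzw : z = w
      · subst hzw
        exact .inr ⟨hC.ne₁.symm, by simp [hwuniq x hx hxz.symm]⟩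
      · have hz : z = u ∨ z ∈ K := by
          have := hall z
          tauto
        simp only [hx', hzw, if_false]
        rcases hpar x hx z hz hxz with h | ⟨h1, h2⟩
        · exact .inl ⟨hx'.1, h⟩
        · exact .inr ⟨(hneK h1).1, h2⟩
    intro x z hxz hxa hxb hza hzb
    by_cases hx : x ∈ K
    · exact key x z hxz hx hza hzb
    · by_cases hz : z ∈ K
      · exact (key z x hxz.symm hz hxa hxb).symm
      · exfalso
        have h1 : x = u ∨ x = w := by
          have := hall x
          tauto
        have h2 : z = u ∨ z = w := by
          have := hall z
          tauto
        apply hcol x z hxz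
        rcases h1 with rfl | rfl <;> rcases h2 with rfl | rfl <;> simp [huw]

end SimpleGraph

namespace SimpleGraph

variable {V : Type*} {G : SimpleGraph V}

lemma Choosable.induce {a b : ℕ} (h : G.Choosable a b) (X : Set V) :
    (G.induce X).Choosable a b := by
  classical
  intro S hS
  obtain ⟨C, hC, hCb, hadj⟩ := h (fun v => if hv : v ∈ X then S ⟨v, hv⟩ else Finset.range a)
    (fun v => by by_cases hv : v ∈ X <;> simp [hv, hS])
  refine ⟨fun v => C v, fun v => ?_, fun v => hCb v, fun u v huv => hadj u v huv⟩
  simpa using hC v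

lemma Choosable.of_induce_compl {a b : ℕ} {X : Set V} (hX : (G.induce X).Choosable a b)
    (hX' : (G.induce Xᶜ).Choosable a b) (hcl : ∀ x ∈ X, ∀ y, G.Adj x y → y ∈ X) :
    G.Choosable a b := by
  classical
  intro S hS
  obtain ⟨C, hC, hCb, hadj⟩ := hX (fun v => S v) (fun v => hS v)
  obtain ⟨C', hC', hCb', hadj'⟩ := hX' (fun v => S v) (fun v => hS v)
  refine ⟨fun v => if hv : v ∈ X then C ⟨v, hv⟩ else C' ⟨v, hv⟩, fun v => ?_, fun v => ?_,
    fun u v huv => ?_⟩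
  · by_cases hv : v ∈ X
    · simpa [hv] using hC ⟨v, hv⟩
    · simpa [hv] using hC' ⟨v, hv⟩
  · by_cases hv : v ∈ X
    · simpa [hv] using hCb ⟨v, hv⟩
    · simpa [hv] using hCb' ⟨v, hv⟩
  · by_cases hu : u ∈ X
    · have hv := hcl u hu v huv
      simpa [hu, hv] using hadj ⟨u, hu⟩ ⟨v, hv⟩ huv
    · have hv : v ∉ X := fun hv => hu (hcl v hv u huv.symm)
      simpa [hu, hv] using hadj' ⟨u, hu⟩ ⟨v, hv⟩ huv

/-- A vertex with at most one neighbour can be coloured last. -/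
lemma Choosable.of_induce_compl_singleton {x z : V} (h : (G.induce {x}ᶜ).Choosable 4 2)
    (hz : ∀ y, G.Adj x y → y = z) : G.Choosable 4 2 := by
  classical
  intro S hS
  obtain ⟨C, hC, hCb, hadj⟩ := h (fun v => S v) (fun v => hS v)
  let D : Finset ℕ := if hzx : z ≠ x then C ⟨z, hzx⟩ else ∅
  have hD : D.card ≤ 2 := by
    unfold D
    split_ifs
    · exact (hCb _).le
    · simp
  have hcard : 2 ≤ (S x \ D).card := by
    have := Finset.le_card_sdiff D (S x)
    have := hS x
    omega
  obtain ⟨T, hT, hT2⟩ := Finset.exists_subset_card_eq hcard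
  have hxD : ∀ y (hy : y ≠ x), G.Adj x y → Disjoint T (C ⟨y, hy⟩) := by
    intro y hy hxy
    obtain rfl := hz y hxy
    have hDC : D = C ⟨y, hy⟩ := dif_pos hy
    rw [← hDC]
    exact Finset.disjoint_of_subset_left hT Finset.sdiff_disjoint
  refine ⟨fun v => if hv : v ≠ x then C ⟨v, hv⟩ else T, fun v => ?_, fun v => ?_,
    fun u v huv => ?_⟩
  · by_cases hv : v = x
    · subst hv
      simpa using hT.trans Finset.sdiff_subset
    · simpa [hv] using hC ⟨v, hv⟩
  · by_cases hv : v = x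
    · simpa [hv] using hT2
    · simpa [hv] using hCb ⟨v, hv⟩
  · by_cases hu : u = x
    · subst hu
      simpa [huv.ne'] using hxD v huv.ne' huv
    · by_cases hv : v = x
      · subst hv
        simpa [hu] using (hxD u hu huv.symm).symm
      · simpa [hu, hv] using hadj ⟨u, hu⟩ ⟨v, hv⟩ huv

lemma Choosable.four_two_of_connectedOn [Finite V] [Nonempty V] (h : G.Choosable 2 1)
    (hconn : G.ConnectedOn Set.univ) (hdeg : ∀ x z, ∃ y, G.Adj x y ∧ y ≠ z) :
    G.Choosable 4 2 := by
  obtain ⟨c, hc, hc2⟩ := h.exists_isProper (fun _ => {1, 2}) (by simp)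
  have hcol : ∀ x y, G.Adj x y → decide (c x = 1) ≠ decide (c y = 1) := by
    intro x y hxy
    have h1 := hc x y hxy
    have h2 := hc2 x
    have h3 := hc2 y
    simp only [Finset.mem_insert, Finset.mem_singleton] at h2 h3
    rcases h2 with h2 | h2 <;> rcases h3 with h3 | h3 <;> simp_all
  have hconn' := fun v => h.connectedOn_compl_singleton hconn hdeg v
  by_cases hdeg₂ : ∀ x y₁ y₂ y₃, G.Adj x y₁ → G.Adj x y₂ → G.Adj x y₃ →
      y₁ = y₂ ∨ y₁ = y₃ ∨ y₂ = y₃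
  · exact choosable_four_two_of_degree_le_two (hconn' (Classical.arbitrary V)) hdeg hdeg₂ hcol
  · push Not at hdeg₂
    obtain ⟨u, k, q, r, huk, huq, hur, hkq, hkr, hqr⟩ := hdeg₂
    obtain ⟨w, a, b, hwu, hab, hua, hub, hwa, hwb⟩ :=
      h.exists_four_cycle (hconn' u) hcol huk huq hur hkq hkr hqr
    have hC : G.IsFourCycle u a w b := ⟨hua, hwa.symm, hwb, hub.symm, hwu.symm, hab⟩
    have key : ∀ t, G.Adj u t → t ≠ a → t ≠ b → G.Choosable 4 2 := fun t hut hta htb =>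
      choosable_four_two_of_isFourCycle h hcol hconn' hC hut hta htb
    by_contra hcon
    have hk : k = a ∨ k = b := by by_contra! hk; exact hcon (key k huk hk.1 hk.2)
    have hq : q = a ∨ q = b := by by_contra! hq; exact hcon (key q huq hq.1 hq.2)
    have hr : r = a ∨ r = b := by by_contra! hr; exact hcon (key r hur hr.1 hr.2)
    grind

lemma Choosable.four_two [Finite V] (h : G.Choosable 2 1) : G.Choosable 4 2 := by
  induction hn : Nat.card V using Nat.strong_induction_on generalizing V with
  | _ n ih =>
    have ih' : ∀ X : Set V, X ≠ Set.univ → (G.induce X).Choosable 4 2 := fun X hX =>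
      ih _ (hn ▸ Set.ncard_lt_card hX) (h.induce X) rfl
    by_cases hV : Nonempty V
    swap
    · rw [not_nonempty_iff] at hV
      exact fun S _ => ⟨S, fun v => subset_rfl, fun v => isEmptyElim v, fun v => isEmptyElim v⟩
    by_cases hdeg : ∀ x z, ∃ y, G.Adj x y ∧ y ≠ z
    swap
    · push Not at hdeg
      obtain ⟨x, z, hxz⟩ := hdeg
      exact .of_induce_compl_singleton (ih' {x}ᶜ (by simp [Set.ext_iff])) hxz
    by_cases hconn : G.ConnectedOn Set.univ
    · exact h.four_two_of_connectedOn hconn hdeg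
    · simp only [ConnectedOn] at hconn
      push Not at hconn
      obtain ⟨X, -, hne, hcl, hX⟩ := hconn
      refine .of_induce_compl (X := X) (ih' X ?_) (ih' Xᶜ ?_) fun x hx y hxy =>
        hcl x hx y (Set.mem_univ y) hxy
      · rintro rfl
        exact hX subset_rfl
      · simpa using hne.ne_empty

end SimpleGraph

theorem two_choosable_is_four_two_choosable {V : Type*} [Fintype V]
    (G : SimpleGraph V) (h : G.Choosable 2 1) :
    G.Choosable 4 2 :=
  h.four_two
end

section
/- Let n and k be positive integers, and let G be a (3k+1)-regular finite simple graph on 3kn vertices. Assume G has a decomposition into a Hamiltonian circuit and n pairwise vertex-disjoint 3k-cliques (every edge of G lies in exactly one of these). Then ch(G) = 3k. -/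
section

open Finset

theorem sum_eq_zero_of_forall_sum_update_eq_zero {T M : Type*} [Fintype T] [DecidableEq T]
    [AddCommMonoid M] (f : (T → Fin 3) → M) (i : T)
    (h : ∀ c, ∑ a, f (Function.update c i a) = 0) : ∑ c, f c = 0 := by
  rw [← (Equiv.funSplitAt i (Fin 3)).symm.sum_comp, Fintype.sum_prod_type_right]
  refine Finset.sum_eq_zero fun r _ => ?_
  rw [← h ((Equiv.funSplitAt i (Fin 3)).symm (0, r))]
  refine Finset.sum_congr rfl fun a _ => congrArg f ?_
  funext j
  by_cases hj : j = i
  · subst hj; simp [Equiv.funSplitAt, Equiv.piSplitAt]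
  · simp [Equiv.funSplitAt, Equiv.piSplitAt, hj]

section Parity

variable {T : Type*} [Fintype T] [DecidableEq T] {x : T → Fin 3 → T → Fin 3 → ZMod 2}

theorem sum_prod_eq_zero_of_not_surjective
    (hsum : ∀ i j b, i ≠ j → ∑ a, x i a j b = 0) (φ : T → T) (hφ : ¬ φ.Surjective) :
    ∑ c : T → Fin 3, ∏ i, x i (c i) (φ i) (c (φ i)) = 0 := by
  simp only [Function.Surjective, not_forall, not_exists] at hφ
  obtain ⟨i, hi⟩ := hφ
  refine sum_eq_zero_of_forall_sum_update_eq_zero _ i fun c => ?_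
  have hterm : ∀ a, ∏ j, x j (Function.update c i a j) (φ j) (Function.update c i a (φ j)) =
      x i a (φ i) (c (φ i)) * ∏ j ∈ univ.erase i, x j (c j) (φ j) (c (φ j)) := by
    intro a
    rw [← Finset.mul_prod_erase univ _ (mem_univ i)]
    congr 1
    · simp [hi i]
    · refine Finset.prod_congr rfl fun j hj => ?_
      simp [hi j, (Finset.mem_erase.1 hj).1]
  simp_rw [hterm]
  rw [← Finset.sum_mul, hsum i (φ i) _ (Ne.symm (hi i)), zero_mul]

theorem sum_prod_eq_zero_of_two_cycle
    (hsym : ∀ i a j b, i ≠ j → x i a j b = x j b i a)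
    (hsum : ∀ i j b, i ≠ j → ∑ a, x i a j b = 0) (π : Equiv.Perm T) (i : T)
    (hi : π i ≠ i) (hii : π (π i) = i) :
    ∑ c : T → Fin 3, ∏ j, x j (c j) (π j) (c (π j)) = 0 := by
  refine sum_eq_zero_of_forall_sum_update_eq_zero _ i fun c => ?_
  have hterm : ∀ a, ∏ j, x j (Function.update c i a j) (π j) (Function.update c i a (π j)) =
      x i a (π i) (c (π i)) *
        ∏ j ∈ (univ.erase i).erase (π i), x j (c j) (π j) (c (π j)) := by
    intro a
    rw [← Finset.mul_prod_erase univ _ (mem_univ i),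
      ← Finset.mul_prod_erase (univ.erase i) _ (mem_erase.2 ⟨hi, mem_univ _⟩), ← mul_assoc]
    congr 1
    · simp only [Function.update_self, hii, Function.update_of_ne hi]
      rw [hsym (π i) _ i a hi]
      generalize x i a (π i) (c (π i)) = y
      revert y; decide
    · refine Finset.prod_congr rfl fun j hj => ?_
      have h1 : j ≠ i := by grind
      have h2 : π j ≠ i := by
        intro h
        have : j = π i := π.injective (by rw [h, hii])
        grind
      simp [h1, h2]
  simp_rw [hterm]
  rw [← Finset.sum_mul, hsum i (π i) _ hi.symm, zero_mul]

theorem sum_prod_inv (hsym : ∀ i a j b, i ≠ j → x i a j b = x j b i a) (π : Equiv.Perm T) :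
    ∑ c : T → Fin 3, ∏ j, x j (c j) (π⁻¹ j) (c (π⁻¹ j)) =
      ∑ c : T → Fin 3, ∏ j, x j (c j) (π j) (c (π j)) := by
  refine Finset.sum_congr rfl fun c _ => ?_
  rw [← Equiv.prod_comp π]
  refine Finset.prod_congr rfl fun j _ => ?_
  by_cases h : π j = j
  · rw [h, Equiv.Perm.inv_eq_iff_eq.2 h.symm]
  · simpa using hsym (π j) (c (π j)) j (c j) h

/-- An odd number of ways to choose one of three alternatives for each index such that every
chosen alternative interacts with an even number of the others. -/
theorem sum_prod_sum_eq_one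
    (hsym : ∀ i a j b, i ≠ j → x i a j b = x j b i a)
    (hdiag : ∀ i a, x i a i a = 1)
    (hsum : ∀ i j b, i ≠ j → ∑ a, x i a j b = 0) :
    ∑ c : T → Fin 3, ∏ i, ∑ j, x i (c i) j (c j) = 1 := by
  simp_rw [Finset.prod_univ_sum, Fintype.piFinset_univ]
  rw [Finset.sum_comm]
  rw [← Fintype.sum_of_injective (fun π : Equiv.Perm T => (π : T → T)) DFunLike.coe_injective
    (fun π => ∑ c : T → Fin 3, ∏ j, x j (c j) (π j) (c (π j))) _ ?_ fun _ => rfl]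
  · rw [← Finset.add_sum_erase univ _ (mem_univ 1)]
    have h1 : ∑ c : T → Fin 3, ∏ j, x j (c j) ((1 : Equiv.Perm T) j) (c ((1 : Equiv.Perm T) j)) =
        1 := by
      simp only [Equiv.Perm.coe_one, id_eq, hdiag, prod_const_one, sum_const, card_univ]
      rw [Fintype.card_fun, Fintype.card_fin, nsmul_eq_mul, mul_one, Nat.cast_pow,
        show ((3 : ℕ) : ZMod 2) = 1 from rfl, one_pow]
    rw [h1, add_eq_left]
    refine Finset.sum_involution (fun π _ => π⁻¹) ?_ ?_ ?_ ?_
    · intro π _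
      rw [sum_prod_inv hsym]
      exact CharTwo.add_self_eq_zero _
    · intro π hπ hne hinv
      refine hne ?_
      obtain ⟨i, hi⟩ : ∃ i, π i ≠ i := by
        by_contra! hcon
        exact (mem_erase.1 hπ).1 (Equiv.ext hcon)
      refine sum_prod_eq_zero_of_two_cycle hsym hsum π i hi ?_
      rw [← Equiv.Perm.eq_inv_iff_eq, hinv]
    · intro π hπ
      simpa using hπ
    · intro π _
      simp
  · intro φ hφ
    refine sum_prod_eq_zero_of_not_surjective hsum φ fun hs => hφ ?_
    exact ⟨Equiv.ofBijective φ (Finite.surjective_iff_bijective.1 hs), rfl⟩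

end Parity

/-- The number of edges for which the orientation `s` selects the endpoint `v`, where `s` selects
`a e` or `b e` for each edge `e`. -/
def outDeg {E V : Type*} [Fintype E] [DecidableEq V] (a b : E → V) (s : E → Bool) (v : V) : ℕ :=
  #{e | (if s e then a e else b e) = v}

theorem coeff_prod_X_sub_X {E V : Type*} [Fintype E] [DecidableEq E] [Fintype V] [DecidableEq V]
    (a b : E → V) (d : V →₀ ℕ) :
    (∏ e, (MvPolynomial.X (a e) - MvPolynomial.X (b e)) : MvPolynomial V ℤ).coeff d =
      ∑ s : E → Bool, if ∀ v, outDeg a b s v = d v then ∏ e, (if s e then 1 else -1) else 0 := by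
  have hX : ∀ e, (MvPolynomial.X (a e) - MvPolynomial.X (b e) : MvPolynomial V ℤ) =
      ∑ s : Bool, MvPolynomial.monomial (Finsupp.single (if s then a e else b e) 1)
        (if s then 1 else -1) := by
    intro e
    simp [MvPolynomial.X, sub_eq_add_neg]
  simp_rw [hX, Finset.prod_univ_sum, Fintype.piFinset_univ, ← MvPolynomial.monomial_sum_prod,
    MvPolynomial.coeff_sum, MvPolynomial.coeff_monomial]
  refine Finset.sum_congr rfl fun s _ => ?_
  congr 1
  rw [eq_iff_iff, Finsupp.ext_iff]
  refine forall_congr' fun v => ?_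
  rw [outDeg, Finset.card_filter, Finsupp.finsetSum_apply]
  simp only [Finsupp.single_apply]

/-- If an odd number of orientations which do not select `a e₀` at the edge `e₀` have all
out-degrees equal to two, and reversing an orientation takes out-degree `m` to `4 - m`, then the
multigraph can be properly colored from lists of size three. -/
theorem exists_coloring_of_odd_orientations {E V : Type*} [Fintype E] [DecidableEq E] [Fintype V]
    [DecidableEq V] (a b : E → V) (hE : Even (Fintype.card E))
    (hdeg : ∀ s v, outDeg a b s v + outDeg a b (fun e => !s e) v = 4) (e₀ : E)
    (hodd : (∑ s : E → Bool, if s e₀ = false ∧ ∀ v, outDeg a b s v = 2 then 1 else 0 : ZMod 2) = 1)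
    (L : V → Finset ℕ) (hL : ∀ v, 3 ≤ #(L v)) :
    ∃ c : V → ℕ, (∀ v, c v ∈ L v) ∧ ∀ e, c (a e) ≠ c (b e) := by
  set P : MvPolynomial V ℤ := ∏ e, (MvPolynomial.X (a e) - MvPolynomial.X (b e)) with hP
  set d : V →₀ ℕ := Finsupp.equivFunOnFinite.symm fun _ => 2 with hd
  have hcoeff : P.coeff d = 2 * ∑ s : E → Bool,
      if s e₀ = false ∧ ∀ v, outDeg a b s v = 2 then ∏ e, (if s e then 1 else -1) else 0 := by
    rw [hP, coeff_prod_X_sub_X, two_mul]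
    have hsplit : ∀ s : E → Bool,
        (if ∀ v, outDeg a b s v = d v then ∏ e, (if s e then 1 else -1 : ℤ) else 0) =
          (if s e₀ = false ∧ ∀ v, outDeg a b s v = 2 then ∏ e, (if s e then 1 else -1) else 0) +
          (if s e₀ = true ∧ ∀ v, outDeg a b s v = 2 then ∏ e, (if s e then 1 else -1) else 0) := by
      intro s
      cases s e₀ <;> simp [hd]
    simp_rw [hsplit, Finset.sum_add_distrib]
    congr 1
    let flip : (E → Bool) ≃ (E → Bool) := Equiv.piCongrRight fun _ => Equiv.boolNot
    rw [← flip.sum_comp]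
    refine Finset.sum_congr rfl fun s _ => ?_
    have hflip : flip s = fun e => !s e := rfl
    have hiff : (∀ v, outDeg a b (flip s) v = 2) ↔ ∀ v, outDeg a b s v = 2 := by
      refine forall_congr' fun v => ?_
      have := hdeg s v
      rw [hflip]
      omega
    have hsign : ∏ e, (if flip s e then 1 else -1 : ℤ) = ∏ e, (if s e then 1 else -1) := by
      have : ∀ e, (if flip s e then 1 else -1 : ℤ) = -1 * (if s e then 1 else -1) := by
        intro e
        simp only [hflip]
        cases s e <;> simp
      simp_rw [this, Finset.prod_mul_distrib, Finset.prod_const, Finset.card_univ,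
        hE.neg_one_pow, one_mul]
    simp only [hiff, hsign]
    simp [hflip]
  have hne : P.coeff d ≠ 0 := by
    rw [hcoeff]
    refine mul_ne_zero two_ne_zero fun h => ?_
    have h2 := congrArg (Int.cast : ℤ → ZMod 2) h
    rw [Int.cast_sum] at h2
    have hcast : ∀ s : E → Bool, ((∏ e, (if s e then 1 else -1 : ℤ) : ℤ) : ZMod 2) = 1 := by
      intro s
      rw [Int.cast_prod]
      refine Finset.prod_eq_one fun e _ => ?_
      cases s e <;> simp
    simp only [apply_ite (Int.cast : ℤ → ZMod 2), hcast, Int.cast_zero] at h2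
    rw [hodd] at h2
    exact one_ne_zero h2
  have hhom : P.IsHomogeneous (∑ _e : E, 1) :=
    MvPolynomial.IsHomogeneous.prod _ _ _ fun e _ =>
      (MvPolynomial.isHomogeneous_X _ _).sub (MvPolynomial.isHomogeneous_X _ _)
  have hP0 : P ≠ 0 := fun h => hne (by simp [h])
  obtain ⟨c, hcL, hc⟩ := MvPolynomial.combinatorial_nullstellensatz_exists_eval_nonzero P d hne
    (by rw [hhom.totalDegree hP0, ← hhom hne, Finsupp.degree_eq_weight_one]; rfl)
    (fun v => (L v).map Nat.castEmbedding) (fun v => by rw [Finset.card_map]; exact hL v)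
  have hcL' : ∀ v, ∃ m ∈ L v, (m : ℤ) = c v := fun v => by simpa using hcL v
  choose m hm hmc using hcL'
  refine ⟨m, hm, fun e he => hc ?_⟩
  rw [hP, map_prod]
  refine Finset.prod_eq_zero (mem_univ e) ?_
  simp [← hmc, he]

theorem outDeg_equiv {E V : Type*} [Fintype E] [DecidableEq V] (a b : E ≃ V)
    (s : E → Bool) (v : V) :
    outDeg a b s v = (s (a.symm v)).toNat + (!s (b.symm v)).toNat := by
  classical
  have hterm : ∀ e, (if (if s e then a e else b e) = v then 1 else 0) =
      (if e = a.symm v then (s e).toNat else 0) + (if e = b.symm v then (!s e).toNat else 0) := by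
    intro e
    simp only [Equiv.eq_symm_apply]
    cases s e <;> simp
  rw [outDeg, Finset.card_filter]
  simp_rw [hterm, Finset.sum_add_distrib]
  simp

theorem outDeg_sumElim {E F V : Type*} [Fintype E] [Fintype F] [DecidableEq V] (a b : E → V)
    (a' b' : F → V) (s : E ⊕ F → Bool) (v : V) :
    outDeg (Sum.elim a a') (Sum.elim b b') s v =
      outDeg a b (fun e => s (Sum.inl e)) v + outDeg a' b' (fun e => s (Sum.inr e)) v := by
  simp only [outDeg, Finset.card_filter, Fintype.sum_sum_type, Sum.elim_inl, Sum.elim_inr]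
  rfl

/-- The parity of the number of orientations of a triangle which complement the prescribed
orientation of the path edges at its three vertices. -/
theorem triangle_orientations (p q : Fin 3 → Bool) :
    (∑ h : Fin 3 → Bool, if ∀ j, (p j).toNat + (!q j).toNat + ((h j).toNat + (!h (j - 1)).toNat) = 2
      then 1 else 0 : ZMod 2) =
    ∑ j, if ∀ i, (p i = q i ↔ i = j) then ∑ i ∈ {j}ᶜ, (if p i then 1 else 0) else 0 := by
  revert p q
  decide +kernel

theorem exists_colors_splitting_off_triple {V : Type*} [DecidableEq V] (A : Finset V)
    (S : V → Finset ℕ) (hA : 3 ≤ #A) (hS : ∀ v ∈ A, 3 ≤ #(S v)) :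
    ∃ (R : Finset ℕ) (B : Finset V), B ⊆ A ∧ #B = 3 ∧ (∀ v ∈ B, 3 ≤ #(S v ∩ R)) ∧
      ∀ v ∈ A \ B, #(S v ∩ R) ≤ 3 := by
  have hex : ∃ R : Finset ℕ, 3 ≤ #{v ∈ A | 3 ≤ #(S v ∩ R)} := by
    refine ⟨A.biUnion S, ?_⟩
    rwa [Finset.filter_true_of_mem]
    intro v hv
    rw [Finset.inter_eq_left.2 (Finset.subset_biUnion_of_mem S hv)]
    exact hS v hv
  obtain ⟨R, hR, hmin⟩ := exists_minimal_of_wellFoundedLT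
    (fun R : Finset ℕ => 3 ≤ #{v ∈ A | 3 ≤ #(S v ∩ R)}) hex
  have hne : R.Nonempty := by
    rw [Finset.nonempty_iff_ne_empty]
    rintro rfl
    simp at hR
  obtain ⟨r, hr⟩ := hne
  have hfew : #{v ∈ A | 3 ≤ #(S v ∩ R.erase r)} < 3 := by
    by_contra! hcon
    exact Finset.notMem_erase r R (hmin hcon (Finset.erase_subset r R) hr)
  have hsub : {v ∈ A | 3 < #(S v ∩ R)} ⊆ {v ∈ A | 3 ≤ #(S v ∩ R.erase r)} := by
    intro v hv
    rw [Finset.mem_filter] at hv ⊢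
    refine ⟨hv.1, ?_⟩
    rw [Finset.inter_erase]
    have := Finset.pred_card_le_card_erase (s := S v ∩ R) (a := r)
    omega
  obtain ⟨B, hB₁, hB₂, hB⟩ := Finset.exists_subsuperset_card_eq
    (s := {v ∈ A | 3 < #(S v ∩ R)}) (t := {v ∈ A | 3 ≤ #(S v ∩ R)}) (n := 3)
    (fun v hv => by rw [Finset.mem_filter] at hv ⊢; exact ⟨hv.1, hv.2.le⟩)
    ((Finset.card_le_card hsub).trans hfew.le) hR
  refine ⟨R, B, fun v hv => (Finset.mem_filter.1 (hB₂ hv)).1, hB,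
    fun v hv => (Finset.mem_filter.1 (hB₂ hv)).2, fun v hv => ?_⟩
  by_contra! hcon
  rw [Finset.mem_sdiff] at hv
  exact hv.2 (hB₁ (Finset.mem_filter.2 ⟨hv.1, hcon⟩))

/-- A set of `3 * k` vertices with lists of size at least `3 * k` can be split into `k` triples,
and the colors into `k` classes, such that each vertex has three colors in its class. -/
theorem exists_triples_and_color_classes {V : Type*} [DecidableEq V] (k : ℕ) :
    ∀ (A : Finset V) (S : V → Finset ℕ), #A = 3 * k → (∀ v ∈ A, 3 * k ≤ #(S v)) →
      ∃ (g : V → ℕ) (h : ℕ → ℕ), (∀ v ∈ A, g v < k) ∧ (∀ j < k, #{v ∈ A | g v = j} = 3) ∧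
        ∀ v ∈ A, 3 ≤ #{c ∈ S v | h c = g v} := by
  induction k with
  | zero =>
    intro A S hA _
    have : A = ∅ := by simpa using hA
    subst this
    exact ⟨fun _ => 0, fun _ => 0, by simp⟩
  | succ k ih =>
    intro A S hA hS
    obtain ⟨R, B, hBA, hB, hin, hout⟩ := exists_colors_splitting_off_triple A S (by omega)
      fun v hv => by have := hS v hv; omega
    obtain ⟨g, h, hg, hfib, hcol⟩ := ih (A \ B) (fun v => S v \ R)
      (by rw [Finset.card_sdiff_of_subset hBA]; omega) (fun v hv => by
        have h1 := hS v (Finset.mem_sdiff.1 hv).1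
        have h2 := hout v hv
        have h3 := Finset.card_sdiff_add_card_inter (S v) R
        omega)
    refine ⟨fun v => if v ∈ B then k else g v, fun c => if c ∈ R then k else h c, ?_, ?_, ?_⟩
    · intro v hv
      by_cases hvB : v ∈ B
      · simp [hvB]
      · have := hg v (Finset.mem_sdiff.2 ⟨hv, hvB⟩)
        simp only [hvB, if_false]
        omega
    · intro j hj
      rcases Nat.lt_succ_iff_lt_or_eq.1 hj with hj | rfl
      · rw [← hfib j hj]
        congr 1
        ext v
        simp only [mem_filter, mem_sdiff]
        by_cases hvB : v ∈ B
        · simp [hvB, hj.ne']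
        · simp [hvB]
      · rw [← hB]
        congr 1
        ext v
        simp only [mem_filter]
        by_cases hvB : v ∈ B
        · simp [hvB, hBA hvB]
        · simp only [hvB, if_false, iff_false, not_and]
          intro hv
          exact (hg v (Finset.mem_sdiff.2 ⟨hv, hvB⟩)).ne
    · intro v hv
      by_cases hvB : v ∈ B
      · refine (hin v hvB).trans (Finset.card_le_card fun c hc => ?_)
        simp [(Finset.mem_inter.1 hc).1, (Finset.mem_inter.1 hc).2, hvB]
      · refine (hcol v (Finset.mem_sdiff.2 ⟨hv, hvB⟩)).trans (Finset.card_le_card fun c hc => ?_)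
        simp only [mem_filter, mem_sdiff] at hc
        simp [hc.1.1, hc.1.2, hvB, hc.2]

theorem sum_compl_singleton_fin_three {M : Type*} [AddCommMonoid M] (f : Fin 3 → M) (a : Fin 3) :
    ∑ l ∈ {a}ᶜ, f l = f (a + 1) + f (a + 2) := by
  have h : ∀ a : Fin 3, ({a}ᶜ : Finset (Fin 3)) = {a + 1, a + 2} ∧ a + 1 ≠ a + 2 := by decide
  rw [(h a).1, Finset.sum_pair (h a).2]

theorem sum_sum_compl_singleton (f : Fin 3 → ZMod 2) : ∑ a, ∑ l ∈ {a}ᶜ, f l = 0 := by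
  revert f
  decide

/-- The partial sums of `δ` are the unique cyclic sequence of bits which ends in zero and has
`δ` as its sequence of differences. -/
theorem eq_partial_sums_iff {m : ℕ} (δ : Fin (m + 1) → ZMod 2) (hδ : ∑ z, δ z = 0)
    (ε : Fin (m + 1) → Bool) :
    (ε (Fin.last m) = false ∧ ∀ v, (ε v = ε (v - 1) ↔ δ v = 0)) ↔
      ∀ v, (if ε v then 1 else 0 : ZMod 2) = ∑ z, if z ≤ v then δ z else 0 := by
  have hstep : ∀ (p q : Bool) (d : ZMod 2), (p = q ↔ d = 0) ↔
      (if p then 1 else 0 : ZMod 2) = (if q then 1 else 0) + d := by decide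
  have hfalse : ∀ p : Bool, p = false ↔ (if p then 1 else 0 : ZMod 2) = 0 := by decide
  simp_rw [hstep, hfalse (ε (Fin.last m))]
  have hzero : ∑ z, (if z ≤ 0 then δ z else 0) = δ 0 := by
    simp
  have hlast : ∑ z, (if z ≤ Fin.last m then δ z else 0) = 0 := by
    simpa [Fin.le_last] using hδ
  have hsucc : ∀ i : Fin m, ∑ z, (if z ≤ i.succ then δ z else 0) =
      ∑ z, (if z ≤ i.castSucc then δ z else 0) + δ i.succ := by
    intro i
    have hterm : ∀ z, (if z ≤ i.succ then δ z else 0) =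
        (if z ≤ i.castSucc then δ z else 0) + (if z = i.succ then δ z else 0) := by
      intro z
      rcases lt_trichotomy z i.succ with h | h | h
      · simp [h.le, h.ne, Fin.le_castSucc_iff.2 h]
      · simp [h]
      · simp [h.not_ge, h.ne', Fin.le_castSucc_iff, h.not_gt]
    simp_rw [hterm, Finset.sum_add_distrib]
    simp
  have hpred₀ : (0 : Fin (m + 1)) - 1 = Fin.last m := by
    rw [sub_eq_iff_eq_add, Fin.last_add_one]
  have hpred : ∀ i : Fin m, i.succ - 1 = i.castSucc := by
    intro i
    rw [sub_eq_iff_eq_add, Fin.coeSucc_eq_succ]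
  constructor
  · rintro ⟨h₀, h⟩ v
    induction v using Fin.induction with
    | zero => rw [h, hpred₀, h₀, hzero, zero_add]
    | succ i ih => rw [h, hpred, ih, hsucc]
  · intro h
    refine ⟨by rw [h, hlast], fun v => ?_⟩
    refine Fin.cases ?_ (fun i => ?_) v
    · rw [hpred₀, h, h, hlast, hzero, zero_add]
    · rw [hpred, h, h, hsucc]

theorem sum_ite_partial_sums {m : ℕ} (δ : Fin (m + 1) → ZMod 2) (hδ : ∑ z, δ z = 0)
    (f : (Fin (m + 1) → ZMod 2) → ZMod 2) :
    (∑ ε : Fin (m + 1) → Bool,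
      if ε (Fin.last m) = false ∧ ∀ v, (ε v = ε (v - 1) ↔ δ v = 0)
        then f (fun v => if ε v then 1 else 0) else 0) =
      f fun v => ∑ z, if z ≤ v then δ z else 0 := by
  have hbit : ∀ d : ZMod 2, (if decide (d = 1) then 1 else 0) = d := by decide
  have hbit' : ∀ (p : Bool) (d : ZMod 2), (if p then 1 else 0) = d ↔ p = decide (d = 1) := by
    decide
  simp_rw [eq_partial_sums_iff δ hδ, hbit', ← funext_iff]
  rw [Finset.sum_ite_eq_of_mem' _ _ _ (mem_univ _)]
  simp only [hbit]

section CycleAndTriangles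

variable {T : Type*} [Fintype T] {m : ℕ}

/-- The vertex following `t (i, l)` in the cyclic order of the `i`-th triangle. -/
def triangleEndpoint (t : T × Fin 3 ≃ Fin (m + 1)) : T × Fin 3 ≃ Fin (m + 1) :=
  (Equiv.prodCongr (Equiv.refl T) (Equiv.addRight 1)).trans t

theorem outDeg_cycle_and_triangles (t : T × Fin 3 ≃ Fin (m + 1))
    (s : Fin (m + 1) ⊕ T × Fin 3 → Bool) (v : Fin (m + 1)) :
    outDeg (Sum.elim (Equiv.refl _) t) (Sum.elim (Equiv.addRight 1) (triangleEndpoint t)) s v =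
      (s (Sum.inl v)).toNat + (!s (Sum.inl (v - 1))).toNat +
        ((s (Sum.inr (t.symm v))).toNat +
          (!s (Sum.inr ((t.symm v).1, (t.symm v).2 - 1))).toNat) := by
  rw [outDeg_sumElim, outDeg_equiv, outDeg_equiv]
  simp only [triangleEndpoint, Equiv.refl_symm, Equiv.refl_apply, Equiv.addRight_symm,
    Equiv.coe_addRight, sub_eq_add_neg]
  rfl

variable [DecidableEq T]

theorem sum_prod_partial_sums_eq_one (t : T × Fin 3 ≃ Fin (m + 1)) :
    (∑ c : T → Fin 3, ∏ i, ∑ l ∈ {c i}ᶜ, ∑ j, ∑ l' ∈ {c j}ᶜ,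
      if t (j, l') ≤ t (i, l) then 1 else 0 : ZMod 2) = 1 := by
  simp_rw [fun (c : T → Fin 3) (i : T) => Finset.sum_comm (s := {c i}ᶜ) (t := univ)
    (f := fun l j => ∑ l' ∈ {c j}ᶜ, (if t (j, l') ≤ t (i, l) then 1 else 0 : ZMod 2))]
  refine sum_prod_sum_eq_one (x := fun i a j b => ∑ l ∈ {a}ᶜ, ∑ l' ∈ {b}ᶜ,
    (if t (j, l') ≤ t (i, l) then 1 else 0 : ZMod 2)) ?_ ?_ ?_
  · intro i a j b hij
    rw [Finset.sum_comm]
    have hflip : ∀ l l', (if t (j, l') ≤ t (i, l) then 1 else 0 : ZMod 2) =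
        1 + if t (i, l) ≤ t (j, l') then 1 else 0 := by
      intro l l'
      have hne : t (i, l) ≠ t (j, l') := fun h =>
        hij (by simpa using congrArg Prod.fst (t.injective h))
      rcases hne.lt_or_gt with h | h
      · rw [if_neg h.not_ge, if_pos h.le]; rfl
      · rw [if_pos h.le, if_neg h.not_ge]; rfl
    simp_rw [hflip, Finset.sum_add_distrib]
    simp only [sum_const, Finset.card_compl, Finset.card_singleton, Fintype.card_fin]
    rw [add_eq_right]
    rfl
  · intro i a
    have hne : t (i, a + 1) ≠ t (i, a + 2) := by
      intro h
      have : a + 1 = a + 2 := congrArg Prod.snd (t.injective h)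
      exact (by decide : ∀ a : Fin 3, a + 1 ≠ a + 2) a this
    simp only [sum_compl_singleton_fin_three, le_refl, if_true]
    rcases hne.lt_or_gt with h | h
    · rw [if_neg h.not_ge, if_pos h.le]; rfl
    · rw [if_pos h.le, if_neg h.not_ge]; rfl
  · intro i j b _
    exact sum_sum_compl_singleton _

theorem sum_triangle_orientations (t : T × Fin 3 ≃ Fin (m + 1)) (ε : Fin (m + 1) → Bool) :
    (∑ η : T × Fin 3 → Bool, if ∀ v, (ε v).toNat + (!ε (v - 1)).toNat +
        ((η (t.symm v)).toNat + (!η ((t.symm v).1, (t.symm v).2 - 1)).toNat) = 2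
      then 1 else 0 : ZMod 2) =
    ∑ c : T → Fin 3, if ∀ i l, (ε (t (i, l)) = ε (t (i, l) - 1) ↔ l = c i)
      then ∏ i, ∑ l ∈ {c i}ᶜ, (if ε (t (i, l)) then 1 else 0) else 0 := by
  have hterm : ∀ h : T → Fin 3 → Bool,
      (if ∀ v, (ε v).toNat + (!ε (v - 1)).toNat + (((Equiv.curry T (Fin 3) Bool).symm h
          (t.symm v)).toNat + (!(Equiv.curry T (Fin 3) Bool).symm h
          ((t.symm v).1, (t.symm v).2 - 1)).toNat) = 2 then 1 else 0 : ZMod 2) =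
      ∏ i, if ∀ j, (ε (t (i, j))).toNat + (!ε (t (i, j) - 1)).toNat +
        ((h i j).toNat + (!h i (j - 1)).toNat) = 2 then 1 else 0 := by
    intro h
    rw [Fintype.prod_ite_zero, Finset.prod_const_one]
    congr 1
    rw [eq_iff_iff, ← t.forall_congr_right, Prod.forall]
    simp
  rw [← (Equiv.curry T (Fin 3) Bool).symm.sum_comp]
  simp_rw [hterm]
  rw [← Fintype.piFinset_univ, ← Finset.prod_univ_sum (κ := fun _ : T => Fin 3 → Bool)
    (t := fun _ => univ)
    (f := fun i (h : Fin 3 → Bool) => if ∀ j, (ε (t (i, j))).toNat + (!ε (t (i, j) - 1)).toNat +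
        ((h j).toNat + (!h (j - 1)).toNat) = 2 then (1 : ZMod 2) else 0)]
  simp_rw [fun i => triangle_orientations (fun j => ε (t (i, j))) (fun j => ε (t (i, j) - 1))]
  rw [Finset.prod_univ_sum, Fintype.piFinset_univ]
  simp_rw [Fintype.prod_ite_zero]

theorem odd_orientations (t : T × Fin 3 ≃ Fin (m + 1)) :
    (∑ s : Fin (m + 1) ⊕ T × Fin 3 → Bool, if s (Sum.inl (Fin.last m)) = false ∧
      ∀ v, outDeg (Sum.elim (Equiv.refl _) t)
        (Sum.elim (Equiv.addRight 1) (triangleEndpoint t)) s v = 2 then 1 else 0 : ZMod 2) = 1 := by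
  simp_rw [outDeg_cycle_and_triangles]
  rw [← (Equiv.sumArrowEquivProdArrow _ _ _).symm.sum_comp, Fintype.sum_prod_type]
  have hpull : ∀ ε : Fin (m + 1) → Bool,
      (∑ η : T × Fin 3 → Bool, if ε (Fin.last m) = false ∧
        ∀ v, (ε v).toNat + (!ε (v - 1)).toNat +
          ((η (t.symm v)).toNat + (!η ((t.symm v).1, (t.symm v).2 - 1)).toNat) = 2
        then 1 else 0 : ZMod 2) =
      ∑ c : T → Fin 3, if ε (Fin.last m) = false ∧
          ∀ v, (ε v = ε (v - 1) ↔ (t.symm v).2 = c (t.symm v).1)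
        then ∏ i, ∑ l ∈ {c i}ᶜ, (if ε (t (i, l)) then 1 else 0) else 0 := by
    intro ε
    have hiff : ∀ c : T → Fin 3, (∀ v, (ε v = ε (v - 1) ↔ (t.symm v).2 = c (t.symm v).1)) ↔
        ∀ i l, (ε (t (i, l)) = ε (t (i, l) - 1) ↔ l = c i) := by
      intro c
      rw [← t.forall_congr_right, Prod.forall]
      simp
    by_cases h : ε (Fin.last m) = false
    · simp only [h, true_and, hiff]
      exact sum_triangle_orientations t ε
    · simp [h]
  refine (Finset.sum_congr rfl fun ε _ => hpull ε).trans ?_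
  rw [Finset.sum_comm]
  refine Eq.trans ?_ (sum_prod_partial_sums_eq_one t)
  refine Finset.sum_congr rfl fun c _ => ?_
  have hδ : ∀ p : T → Fin 3 → Prop, [∀ i l, Decidable (p i l)] →
      (∑ z, if p (t.symm z).1 (t.symm z).2 then
        (if (t.symm z).2 = c (t.symm z).1 then 0 else 1 : ZMod 2) else 0) =
      ∑ j, ∑ l ∈ {c j}ᶜ, if p j l then 1 else 0 := by
    intro p _
    rw [← t.sum_comp, Fintype.sum_prod_type]
    refine Finset.sum_congr rfl fun j _ => ?_
    rw [← Finset.sum_add_sum_compl {c j}, Finset.sum_singleton]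
    simp only [Equiv.symm_apply_apply, if_true, ite_self, zero_add]
    refine Finset.sum_congr rfl fun l hl => ?_
    rw [if_neg (show ¬ l = c j by simpa using hl)]
  have hsum : ∑ z, (if (t.symm z).2 = c (t.symm z).1 then 0 else 1 : ZMod 2) = 0 := by
    have := hδ (fun _ _ => True)
    simp only [if_true] at this
    rw [this]
    refine Finset.sum_eq_zero fun j _ => ?_
    rw [sum_compl_singleton_fin_three]
    rfl
  have hmain := sum_ite_partial_sums
    (fun z => if (t.symm z).2 = c (t.symm z).1 then 0 else 1) hsum
    fun ε => ∏ i, ∑ l ∈ {c i}ᶜ, ε (t (i, l))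
  simp only [ite_eq_left_iff, one_ne_zero, imp_false, not_not] at hmain
  refine hmain.trans ?_
  refine Finset.prod_congr rfl fun i _ => Finset.sum_congr rfl fun l _ => ?_
  rw [← hδ fun j l' => t (j, l') ≤ t (i, l)]
  simp

/-- The cycle-plus-triangles theorem for list colorings. -/
theorem exists_list_coloring_cycle_and_triangles (t : T × Fin 3 ≃ Fin (m + 1))
    (L : Fin (m + 1) → Finset ℕ) (hL : ∀ v, 3 ≤ #(L v)) :
    ∃ c : Fin (m + 1) → ℕ, (∀ v, c v ∈ L v) ∧ (∀ v, c v ≠ c (v + 1)) ∧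
      ∀ i, Function.Injective fun l => c (t (i, l)) := by
  obtain ⟨c, hcL, hc⟩ := exists_coloring_of_odd_orientations
    (Sum.elim (Equiv.refl _) t) (Sum.elim (Equiv.addRight 1) (triangleEndpoint t))
    (by rw [Fintype.card_sum, Fintype.card_congr t]; exact Even.add_self _)
    (fun s v => by
      rw [outDeg_cycle_and_triangles, outDeg_cycle_and_triangles]
      generalize s (Sum.inl v) = b₁
      generalize s (Sum.inl (v - 1)) = b₂
      generalize s (Sum.inr (t.symm v)) = b₃
      generalize s (Sum.inr ((t.symm v).1, (t.symm v).2 - 1)) = b₄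
      revert b₁ b₂ b₃ b₄
      decide)
    (Sum.inl (Fin.last m)) (by convert odd_orientations t) L hL
  refine ⟨c, hcL, fun v => hc (Sum.inl v), fun i => ?_⟩
  have hstep : ∀ l, c (t (i, l)) ≠ c (t (i, l + 1)) := fun l => hc (Sum.inr (i, l))
  intro l l' hll
  by_contra hne
  have h : ∀ l l' : Fin 3, l ≠ l' → l' = l + 1 ∨ l = l' + 1 := by decide
  rcases h l l' hne with rfl | rfl
  · exact hstep _ hll
  · exact hstep _ hll.symm

end CycleAndTriangles

theorem exists_cyclic_enumeration {V : Type*} [Fintype V] [DecidableEq V] {G : SimpleGraph V}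
    {v : V} {p : G.Walk v v} (hp : p.IsHamiltonianCycle) :
    ∃ (m : ℕ) (e : Fin (m + 1) ≃ V), ∀ u w, s(u, w) ∈ p.edges →
      ∃ i, s(e i, e (i + 1)) = s(u, w) := by
  have hlen := hp.length_eq
  have hthree := hp.isCycle.three_le_length
  obtain ⟨m, hm⟩ : ∃ m, p.length = m + 1 := ⟨p.length - 1, by omega⟩
  have hinj : Function.Injective fun i : Fin (m + 1) => p.getVert i := by
    intro i j hij
    refine Fin.ext (hp.isCycle.getVert_injOn' ?_ ?_ hij)
    · simp only [Set.mem_ofPred_eq]; omega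
    · simp only [Set.mem_ofPred_eq]; omega
  refine ⟨m, Equiv.ofBijective _ ((Fintype.bijective_iff_injective_and_card _).2
    ⟨hinj, by rw [Fintype.card_fin]; omega⟩), fun u w huw => ?_⟩
  obtain ⟨i, hi, hiuw⟩ := (p.mk_mem_edges_iff_exists).1 huw
  refine ⟨⟨i, by omega⟩, ?_⟩
  rw [← hiuw]
  suffices h : p.getVert ((⟨i, by omega⟩ + 1 : Fin (m + 1)) : ℕ) = p.getVert (i + 1) by
    simp only [Equiv.ofBijective_apply, h]
  rcases Nat.lt_or_ge i m with him | him
  · rw [Fin.val_add_one_of_lt (by simpa [Fin.lt_def] using him)]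
  · obtain rfl : i = m := by omega
    have hlast : (⟨i, by omega⟩ : Fin (i + 1)) + 1 = 0 := Fin.last_add_one i
    rw [hlast, Fin.val_zero, p.getVert_zero, ← hm, p.getVert_length]

theorem exists_equiv_of_card_fiber {V X : Type*} [Fintype V] [DecidableEq X] {r : ℕ}
    (f : V → X) (hf : ∀ x, #{v | f v = x} = r) :
    ∃ t : X × Fin r ≃ V, ∀ x l, f (t (x, l)) = x := by
  have hcard : ∀ x, Fintype.card {v // f v = x} = r := fun x => by
    rw [Fintype.card_subtype, hf]
  refine ⟨(Equiv.sigmaEquivProd X (Fin r)).symm.trans ((Equiv.sigmaCongrRight fun x =>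
    (Fintype.equivFinOfCardEq (hcard x)).symm).trans (Equiv.sigmaFiberEquiv f)), fun x l => ?_⟩
  exact ((Fintype.equivFinOfCardEq (hcard x)).symm l).2

theorem choosable_of_hamiltonian_decomposition {V : Type*} [Fintype V] [DecidableEq V]
    {G : SimpleGraph V} {n k : ℕ} {v : V} {p : G.Walk v v} (hp : p.IsHamiltonianCycle)
    (A : Fin n → Finset V) (hA : ∀ i, #(A i) = 3 * k)
    (hdisj : Pairwise fun i j => Disjoint (A i) (A j)) (hcover : ∀ w, ∃ i, w ∈ A i)
    (hedge : ∀ u w, G.Adj u w → (¬ ∃ i, u ∈ A i ∧ w ∈ A i) → s(u, w) ∈ p.edges) :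
    G.Choosable (3 * k) 1 := by
  intro S hS
  choose cl hcl using hcover
  have hcl_eq : ∀ i w, w ∈ A i ↔ cl w = i := by
    refine fun i w => ⟨fun hw => ?_, fun h => h ▸ hcl w⟩
    by_contra hne
    exact Finset.disjoint_left.1 (hdisj hne) (hcl w) hw
  choose g h hg hfib hcol using fun i =>
    exists_triples_and_color_classes k (A i) S (hA i) fun w _ => (hS w).ge
  obtain ⟨t, ht⟩ := exists_equiv_of_card_fiber (r := 3)
    (fun w => (cl w, (⟨g (cl w) w, hg _ w (hcl w)⟩ : Fin k))) (by
      rintro ⟨i, j⟩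
      rw [← hfib i j j.2]
      congr 1
      ext w
      simp only [mem_filter, mem_univ, true_and, Prod.mk.injEq, Fin.ext_iff, hcl_eq i w]
      refine and_congr_right fun hi => ?_
      rw [Fin.ext hi])
  obtain ⟨m, e, he⟩ := exists_cyclic_enumeration hp
  obtain ⟨c, hcL, hcyc, htri⟩ := exists_list_coloring_cycle_and_triangles (t.trans e.symm)
    (fun x => {a ∈ S (e x) | h (cl (e x)) a = g (cl (e x)) (e x)})
    fun x => hcol _ _ (hcl (e x))
  have hc : ∀ w, c (e.symm w) ∈ S w ∧ h (cl w) (c (e.symm w)) = g (cl w) w := fun w => by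
    simpa using hcL (e.symm w)
  refine ⟨fun w => {c (e.symm w)}, fun w => by simpa using (hc w).1,
    fun w => Finset.card_singleton _, fun u w huw => ?_⟩
  rw [Finset.disjoint_singleton]
  by_cases hclique : ∃ i, u ∈ A i ∧ w ∈ A i
  · obtain ⟨i, hu, hw⟩ := hclique
    rw [hcl_eq] at hu hw
    intro heq
    have hgu := (hc u).2
    have hgw := (hc w).2
    rw [hu] at hgu
    rw [hw, ← heq, hgu] at hgw
    obtain ⟨⟨x, l⟩, rfl⟩ := t.surjective u
    obtain ⟨⟨y, l'⟩, rfl⟩ := t.surjective w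
    have hxy : x = y := by
      rw [← ht x l, ← ht y l']
      simp [hu, hw, hgw]
    subst hxy
    have hl : l = l' := htri x heq
    subst hl
    exact G.loopless.irrefl _ huw
  · obtain ⟨i, hi⟩ := he u w (hedge u w huw hclique)
    rcases Sym2.eq_iff.1 hi with ⟨rfl, rfl⟩ | ⟨rfl, rfl⟩
    · simpa using hcyc i
    · simpa using (hcyc i).symm

theorem card_le_of_choosable_of_isClique {V : Type*} {G : SimpleGraph V} {a : ℕ}
    (hG : G.Choosable a 1) {A : Finset V} (hA : G.IsClique A) : #A ≤ a := by
  obtain ⟨C, hCS, hC, hdisj⟩ := hG (fun _ => Finset.range a) fun _ => Finset.card_range a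
  choose c hc using fun v => Finset.card_eq_one.1 (hC v)
  rw [← Finset.card_range a]
  refine Finset.card_le_card_of_injOn c (fun v _ => hCS v (by simp [hc])) ?_
  intro u hu w hw huw
  by_contra hne
  have := hdisj u w (hA hu hw hne)
  rw [hc, hc, Finset.disjoint_singleton] at this
  exact this huw

end

theorem choice_number_of_hamiltonian_decomposition {V : Type*} [Fintype V] [DecidableEq V]
    (G : SimpleGraph V) [DecidableRel G.Adj] (n k : ℕ) (hn : 0 < n) (hk : 0 < k)
    (hreg : G.IsRegularOfDegree (3 * k + 1))
    (hcard : Fintype.card V = 3 * k * n)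
    (hdecomp : ∃ (v : V) (p : G.Walk v v) (A : Fin n → Finset V),
      p.IsHamiltonianCycle ∧
      (∀ i, (A i).card = 3 * k) ∧
      (Pairwise fun i j => Disjoint (A i) (A j)) ∧
      (∀ w : V, ∃ i, w ∈ A i) ∧
      (∀ i, ∀ u ∈ A i, ∀ w ∈ A i, u ≠ w → G.Adj u w) ∧
      (∀ u w, G.Adj u w → (s(u, w) ∈ p.edges ↔ ¬ ∃ i, u ∈ A i ∧ w ∈ A i))) :
    G.chooseNum 1 = 3 * k := by
  obtain ⟨v, p, A, hp, hA, hdisj, hcover, hclique, hedge⟩ := hdecomp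
  have hch : G.Choosable (3 * k) 1 := choosable_of_hamiltonian_decomposition hp A hA hdisj hcover
    fun u w huw => (hedge u w huw).2
  refine le_antisymm (Nat.sInf_le hch) (le_csInf ⟨_, hch⟩ fun a ha => ?_)
  rw [← hA ⟨0, hn⟩]
  exact card_le_of_choosable_of_isClique ha fun u hu w hw huw => hclique _ u hu w hw huw
end
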